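/- Let 0 < ε < 1 and let 𝒮 be a martingale ε-sparse family of subintervals of [0,1). Let K ∈ 𝐊 and let L be any subinterval of K sharing an endpoint with K. There exists a constant C(p) > 0, depending only on p and independent of k, ε, 𝒮, L, K, and the choices of the intervals I(J), such that Σ_{I ∈ 𝒮, I ⊆ L} ⟨w_k⟩_I^p·⟨σ_k⟩_I·|I| ≤ C(p)·k·w_k(L)/(1−ε) and Σ_{I ∈ 𝒮, I ⊆ L} ⟨σ_k⟩_I^{p'}·⟨w_k⟩_I·|I| ≤ C(p)·k·σ_k(L)/(1−ε), where p' := p/(p−1). -/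

import Mathlib

open MeasureTheory Set Filter

noncomputable section

namespace RTpaper

/-- The half-open interval `[a, b)` represented by the pair `(a, b)`. -/
def ivSet (I : ℝ × ℝ) : Set ℝ := Set.Ico I.1 I.2

/-- The length of the interval represented by `I`. -/
def len (I : ℝ × ℝ) : ℝ := I.2 - I.1

/-- The middle triadic child of an interval. -/
def mid (I : ℝ × ℝ) : ℝ × ℝ := (I.1 + (I.2 - I.1) / 3, I.2 - (I.2 - I.1) / 3)

/-- The families `𝐊ᵢ` of the Reguera–Thiele construction. -/
def Kfam (k : ℕ) : ℕ → Set (ℝ × ℝ)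
  | 0 => {((0 : ℝ), (1 : ℝ))}
  | (i + 1) =>
      {I | ∃ K ∈ Kfam k i, ∃ j : ℕ, j < 3 ^ (k - 1) ∧
        I = ((mid K).1 + (j : ℝ) * ((3 : ℝ) ^ (1 - (k : ℤ)) * len (mid K)),
             (mid K).1 + ((j : ℝ) + 1) * ((3 : ℝ) ^ (1 - (k : ℤ)) * len (mid K)))}

/-- The families `𝐉ᵢ` (of interest for `i ≥ 1`). -/
def Jfam (k i : ℕ) : Set (ℝ × ℝ) := {J | ∃ K ∈ Kfam k (i - 1), J = mid K}

/-- The family `𝐊 = ⋃ᵢ 𝐊ᵢ`. -/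
def KK (k : ℕ) : Set (ℝ × ℝ) := ⋃ i, Kfam k i

/-- The family `𝐉 = ⋃_{i ≥ 1} 𝐉ᵢ`. -/
def JJ (k : ℕ) : Set (ℝ × ℝ) := ⋃ i, Jfam k (i + 1)

/-- The chosen triadic interval `I(J)` adjacent to `J` of length `3^{1-k}|J|`, encoded by a
choice function `ch` deciding, for each `J`, whether `I(J)` lies to the right (`true`) or to
the left (`false`) of `J`. -/
def IJ (k : ℕ) (ch : ℝ × ℝ → Bool) (J : ℝ × ℝ) : ℝ × ℝ :=
  if ch J then (J.2, J.2 + (3 : ℝ) ^ (1 - (k : ℤ)) * len J)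
  else (J.1 - (3 : ℝ) ^ (1 - (k : ℤ)) * len J, J.1)

/-- The weight `w_k = Σ_{i ≥ 1} Σ_{J ∈ 𝐉ᵢ} (3^k/(3^{k-1}+1))^i · 1_{I(J)}`. -/
def wgt (k : ℕ) (ch : ℝ × ℝ → Bool) (x : ℝ) : ℝ :=
  ∑' i : ℕ, ∑' J : ↥(Jfam k (i + 1)),
    Set.indicator (ivSet (IJ k ch (J : ℝ × ℝ)))
      (fun _ => ((3 : ℝ) ^ k / ((3 : ℝ) ^ (k - 1) + 1)) ^ (i + 1)) x

/-- The weight `σ_k = w_k^{1-p}` on `{w_k > 0}`, and `0` elsewhere. -/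
def sgm (p : ℝ) (k : ℕ) (ch : ℝ × ℝ → Bool) (x : ℝ) : ℝ :=
  if 0 < wgt k ch x then wgt k ch x ^ (1 - p) else 0

/-- `u(I) = ∫_I u`. -/
def mass (u : ℝ → ℝ) (I : ℝ × ℝ) : ℝ := ∫ x in ivSet I, u x

/-- `⟨u⟩_I = u(I)/|I|`. -/
def avg (u : ℝ → ℝ) (I : ℝ × ℝ) : ℝ := mass u I / len I

/-- `ch_𝐊(K)`: the members of `𝐊_{i+1}` contained in `K ∈ 𝐊ᵢ`. -/
def chK (k : ℕ) (K : ℝ × ℝ) : Set (ℝ × ℝ) :=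
  {K' | ∃ i, K ∈ Kfam k i ∧ K' ∈ Kfam k (i + 1) ∧ ivSet K' ⊆ ivSet K}

/-- Triadic intervals of `ℝ`. -/
def IsTriadic (I : ℝ × ℝ) : Prop :=
  ∃ n j : ℤ, I.1 = (j : ℝ) * (3 : ℝ) ^ (-n) ∧ I.2 = ((j : ℝ) + 1) * (3 : ℝ) ^ (-n)

/-- Maximal members of `S` strictly contained in `R`. -/
def maxIn (S : Set (ℝ × ℝ)) (R : ℝ × ℝ) : Set (ℝ × ℝ) :=
  {Q | Q ∈ S ∧ ivSet Q ⊂ ivSet R ∧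
    ∀ Q' ∈ S, ivSet Q ⊆ ivSet Q' → ivSet Q' ⊂ ivSet R → ivSet Q' = ivSet Q}

/-- Martingale `ε`-sparse families of (half-open) intervals. -/
def MSparse (ε : ℝ) (S : Set (ℝ × ℝ)) : Prop :=
  S.Countable ∧ (∀ I ∈ S, I.1 < I.2) ∧
    (∀ I ∈ S, ∀ J ∈ S, ivSet I ⊆ ivSet J ∨ ivSet J ⊆ ivSet I ∨ ivSet I ∩ ivSet J = ∅) ∧
    ∀ R ∈ S, (∑' Q : ↥(maxIn S R), len (Q : ℝ × ℝ)) ≤ ε * len R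

/-- `Σ_{I ∈ F} ⟨u⟩_I^q · ⟨v⟩_I · |I|`. -/
def sumTest (q : ℝ) (u v : ℝ → ℝ) (F : Set (ℝ × ℝ)) : ℝ :=
  ∑' I : ↥F, avg u (I : ℝ × ℝ) ^ q * avg v (I : ℝ × ℝ) * len (I : ℝ × ℝ)



/-! ### Geometry -/

/-- Children. -/
def chd (k : ℕ) (K : ℝ × ℝ) (j : ℕ) : ℝ × ℝ :=
  (K.1 + len K / 3 + (j : ℝ) * (len K / 3 ^ k), K.1 + len K / 3 + ((j : ℝ) + 1) * (len K / 3 ^ k))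

lemma z3 (k : ℕ) : (3 : ℝ) ^ (1 - (k : ℤ)) = 3 / 3 ^ k := by
  rw [zpow_sub₀ (by norm_num)]; simp

lemma len_mid (K : ℝ × ℝ) : len (mid K) = len K / 3 := by
  simp only [len, mid]; ring

lemma dd (k : ℕ) (K : ℝ × ℝ) : (3 : ℝ) ^ (1 - (k : ℤ)) * len (mid K) = len K / 3 ^ k := by
  rw [z3, len_mid]; field_simp

lemma mid_fst (K : ℝ × ℝ) : (mid K).1 = K.1 + len K / 3 := by
  simp only [len, mid]

lemma mid_snd (K : ℝ × ℝ) : (mid K).2 = K.1 + 2 * (len K / 3) := by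
  simp only [len, mid]; ring

lemma Kfam_succ (k i : ℕ) (I : ℝ × ℝ) :
    I ∈ Kfam k (i + 1) ↔ ∃ K ∈ Kfam k i, ∃ j < 3 ^ (k - 1), I = chd k K j := by
  simp only [Kfam, dd, mid_fst, chd, mem_ofPred_eq]

lemma len_chd (k : ℕ) (K : ℝ × ℝ) (j : ℕ) : len (chd k K j) = len K / 3 ^ k := by
  simp only [len, chd]; ring

lemma len_Kfam (k i : ℕ) : ∀ K ∈ Kfam k i, len K = 1 / (3 ^ k) ^ i := by
  induction i with
  | zero => intro K hK; simp only [Kfam, mem_singleton_iff] at hK; subst hK; simp [len]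
  | succ i ih =>
    intro K hK
    obtain ⟨K', hK', j, hj, rfl⟩ := (Kfam_succ k i K).1 hK
    rw [len_chd, ih K' hK', pow_succ]; field_simp

lemma len_Kfam_pos {k i : ℕ} {K : ℝ × ℝ} (hK : K ∈ Kfam k i) : 0 < len K := by
  rw [len_Kfam k i K hK]; positivity

lemma pow3 {k : ℕ} (hk : 3000 < k) : (3 : ℝ) ^ k = 3 * 3 ^ (k - 1) := by
  obtain ⟨m, rfl⟩ : ∃ m, k = m + 1 := ⟨k - 1, by omega⟩
  simp [pow_succ]; ring

lemma ND {k : ℕ} (hk : 3000 < k) (K : ℝ × ℝ) : (3 : ℝ) ^ (k - 1) * (len K / 3 ^ k) = len K / 3 := by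
  rw [pow3 hk]; field_simp

lemma pow3_ge {k : ℕ} (hk : 3000 < k) : (1000 : ℝ) ≤ 3 ^ k := by
  have : (3 : ℝ) ^ 7 ≤ 3 ^ k := pow_le_pow_right₀ (by norm_num) (by omega)
  norm_num at this; linarith

lemma D_small {k : ℕ} (hk : 3000 < k) {K : ℝ × ℝ} (h : 0 < len K) :
    0 < len K / 3 ^ k ∧ len K / 3 ^ k ≤ len K / 1000 := by
  refine ⟨by positivity, ?_⟩
  exact div_le_div_of_nonneg_left h.le (by norm_num) (pow3_ge hk)

/-- The interval I(J_K). -/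
def GK (k : ℕ) (ch : ℝ × ℝ → Bool) (K : ℝ × ℝ) : ℝ × ℝ := IJ k ch (mid K)

lemma GK_cases (k : ℕ) (ch : ℝ × ℝ → Bool) (K : ℝ × ℝ) :
    ((GK k ch K).1 = K.1 + 2 * (len K / 3) ∧ (GK k ch K).2 = K.1 + 2 * (len K / 3) + len K / 3 ^ k) ∨
    ((GK k ch K).1 = K.1 + len K / 3 - len K / 3 ^ k ∧ (GK k ch K).2 = K.1 + len K / 3) := by
  unfold GK IJ
  split_ifs
  · left; simp only [mid_snd, dd, and_self]
  · right; simp only [mid_fst, dd, and_self]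

lemma len_GK (k : ℕ) (ch : ℝ × ℝ → Bool) (K : ℝ × ℝ) : len (GK k ch K) = len K / 3 ^ k := by
  rcases GK_cases k ch K with h | h <;> simp only [len] at * <;> linarith

lemma snd_eq (K : ℝ × ℝ) : K.2 = K.1 + len K := by simp [len]

lemma GK_sub {k : ℕ} (hk : 3000 < k) (ch : ℝ × ℝ → Bool) {K : ℝ × ℝ} (h : 0 < len K) :
    ivSet (GK k ch K) ⊆ ivSet K := by
  intro x hx
  have := D_small hk h
  simp only [ivSet, mem_Ico] at *
  rw [snd_eq K]
  rcases GK_cases k ch K with h' | h' <;> rw [h'.1, h'.2] at hx <;> constructor <;> linarith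

lemma mid_sub {K : ℝ × ℝ} (h : 0 < len K) : ivSet (mid K) ⊆ ivSet K := by
  intro x hx
  simp only [ivSet, mem_Ico, mid_fst, mid_snd] at *
  rw [snd_eq K]
  constructor <;> linarith

lemma GK_disj (k : ℕ) (ch : ℝ × ℝ → Bool) (K : ℝ × ℝ) :
    Disjoint (ivSet (mid K)) (ivSet (GK k ch K)) := by
  rw [Set.disjoint_left]
  intro x hx hx'
  simp only [ivSet, mem_Ico, mid_fst, mid_snd] at *
  rcases GK_cases k ch K with h' | h' <;> rw [h'.1, h'.2] at hx' <;> linarith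

lemma chd_sub {k : ℕ} (hk : 3000 < k) {K : ℝ × ℝ} (h : 0 < len K) {j : ℕ} (hj : j < 3 ^ (k - 1)) :
    ivSet (chd k K j) ⊆ ivSet (mid K) := by
  intro x hx
  have hD := (D_small hk h).1
  have hN := ND hk K
  have hj' : (j : ℝ) + 1 ≤ 3 ^ (k - 1) := by exact_mod_cast hj
  simp only [ivSet, mem_Ico, mid_fst, mid_snd, chd] at *
  have h1 : ((j : ℝ) + 1) * (len K / 3 ^ k) ≤ 3 ^ (k - 1) * (len K / 3 ^ k) := by gcongr
  have h2 : 0 ≤ (j : ℝ) * (len K / 3 ^ k) := by positivity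
  constructor <;> linarith

lemma chd_disj {k : ℕ} (hk : 3000 < k) {K : ℝ × ℝ} (h : 0 < len K) {j j' : ℕ} (hne : j ≠ j') :
    Disjoint (ivSet (chd k K j)) (ivSet (chd k K j')) := by
  have hD := (D_small hk h).1
  have key : ∀ a b : ℕ, a < b → Disjoint (ivSet (chd k K a)) (ivSet (chd k K b)) := by
    intro a b hab
    rw [Set.disjoint_left]
    intro x hx hx'
    have hj' : (a : ℝ) + 1 ≤ b := by exact_mod_cast hab
    simp only [ivSet, mem_Ico, chd] at *
    have h1 : ((a : ℝ) + 1) * (len K / 3 ^ k) ≤ b * (len K / 3 ^ k) := by gcongr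
    linarith
  rcases lt_or_gt_of_ne hne with h' | h'
  · exact key _ _ h'
  · exact (key _ _ h').symm

lemma mid_cover {k : ℕ} (hk : 3000 < k) {K : ℝ × ℝ} (h : 0 < len K) {x : ℝ} (hx : x ∈ ivSet (mid K)) :
    ∃ j < 3 ^ (k - 1), x ∈ ivSet (chd k K j) := by
  have hD := (D_small hk h).1
  have hN := ND hk K
  simp only [ivSet, mem_Ico, mid_fst, mid_snd, chd] at *
  set D := len K / 3 ^ k with hDdef
  set y := (x - (K.1 + len K / 3)) / D with hy
  have hxy : x = K.1 + len K / 3 + y * D := by rw [hy]; field_simp; ring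
  have hy0 : 0 ≤ y := by rw [hy]; apply div_nonneg <;> linarith
  have hyN : y < 3 ^ (k - 1) := by rw [hy, div_lt_iff₀ hD]; linarith
  refine ⟨⌊y⌋₊, ?_, ?_, ?_⟩
  · have : ((⌊y⌋₊ : ℕ) : ℝ) < 3 ^ (k - 1) := lt_of_le_of_lt (Nat.floor_le hy0) hyN
    exact_mod_cast this
  · rw [hxy]; gcongr; exact Nat.floor_le hy0
  · rw [hxy]; gcongr; exact Nat.lt_floor_add_one y

lemma chd_mem {k i : ℕ} {K : ℝ × ℝ} (hK : K ∈ Kfam k i) {j : ℕ} (hj : j < 3 ^ (k - 1)) :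
    chd k K j ∈ Kfam k (i + 1) := (Kfam_succ k i _).2 ⟨K, hK, j, hj, rfl⟩

lemma Kfam_unique {k : ℕ} (hk : 3000 < k) (i : ℕ) : ∀ K ∈ Kfam k i, ∀ K' ∈ Kfam k i, ∀ x,
    x ∈ ivSet K → x ∈ ivSet K' → K = K' := by
  induction i with
  | zero =>
    intro K hK K' hK' x _ _
    simp only [Kfam, mem_singleton_iff] at hK hK'; rw [hK, hK']
  | succ i ih =>
    intro K hK K' hK' x hx hx'
    obtain ⟨K0, hK0, j, hj, rfl⟩ := (Kfam_succ k i K).1 hK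
    obtain ⟨K1, hK1, j', hj', rfl⟩ := (Kfam_succ k i K').1 hK'
    have h0 := len_Kfam_pos hK0
    have h1 := len_Kfam_pos hK1
    have : K0 = K1 := ih K0 hK0 K1 hK1 x (mid_sub h0 (chd_sub hk h0 hj hx))
      (mid_sub h1 (chd_sub hk h1 hj' hx'))
    subst this
    by_cases hjj : j = j'
    · rw [hjj]
    · exact absurd hx' (Set.disjoint_left.1 (chd_disj hk h0 hjj) hx)

/-- level sets -/
def Gs (k : ℕ) (ch : ℝ × ℝ → Bool) (i : ℕ) : Set ℝ := ⋃ K ∈ Kfam k i, ivSet (GK k ch K)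

/-- ancestors -/
lemma Kfam_anc {k : ℕ} (hk : 3000 < k) (i n : ℕ) : ∀ K ∈ Kfam k (i + n + 1), ∀ x ∈ ivSet K,
    ∃ K' ∈ Kfam k i, x ∈ ivSet (mid K') := by
  induction n with
  | zero =>
    intro K hK x hx
    obtain ⟨K0, hK0, j, hj, rfl⟩ := (Kfam_succ k i K).1 hK
    exact ⟨K0, hK0, chd_sub hk (len_Kfam_pos hK0) hj hx⟩
  | succ n ih =>
    intro K hK x hx
    obtain ⟨K0, hK0, j, hj, rfl⟩ := (Kfam_succ k _ K).1 hK
    exact ih K0 hK0 x (mid_sub (len_Kfam_pos hK0) (chd_sub hk (len_Kfam_pos hK0) hj hx))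

lemma Gs_eq {k : ℕ} (hk : 3000 < k) (ch : ℝ × ℝ → Bool) {i : ℕ} {K : ℝ × ℝ} (hK : K ∈ Kfam k i)
    {x : ℝ} (hx : x ∈ ivSet K) : x ∈ Gs k ch i ↔ x ∈ ivSet (GK k ch K) := by
  simp only [Gs, mem_iUnion]
  constructor
  · rintro ⟨K', hK', hx'⟩
    have := Kfam_unique hk i K hK K' hK' x hx (GK_sub hk ch (len_Kfam_pos hK') hx')
    rwa [this]
  · intro h; exact ⟨K, hK, h⟩

lemma Gs_gt {k : ℕ} (hk : 3000 < k) (ch : ℝ × ℝ → Bool) {i m : ℕ} (him : i < m) {K : ℝ × ℝ}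
    (hK : K ∈ Kfam k i) {x : ℝ} (hx : x ∈ ivSet K) (hm : x ∈ Gs k ch m) : x ∈ ivSet (mid K) := by
  simp only [Gs, mem_iUnion] at hm
  obtain ⟨K', hK', hx'⟩ := hm
  obtain ⟨n, rfl⟩ : ∃ n, m = i + n + 1 := ⟨m - i - 1, by omega⟩
  obtain ⟨K'', hK'', hx''⟩ := Kfam_anc hk i n K' hK' x (GK_sub hk ch (len_Kfam_pos hK') hx')
  rwa [Kfam_unique hk i K hK K'' hK'' x hx (mid_sub (len_Kfam_pos hK'') hx'')]

lemma Gs_lt {k : ℕ} (hk : 3000 < k) (ch : ℝ × ℝ → Bool) {i m : ℕ} (him : m < i) {K : ℝ × ℝ}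
    (hK : K ∈ Kfam k i) {x : ℝ} (hx : x ∈ ivSet K) : x ∉ Gs k ch m := by
  intro hm
  obtain ⟨n, rfl⟩ : ∃ n, i = m + n + 1 := ⟨i - m - 1, by omega⟩
  obtain ⟨K'', hK'', hx''⟩ := Kfam_anc hk m n K hK x hx
  have := (Gs_eq hk ch hK'' (mid_sub (len_Kfam_pos hK'') hx'')).1 hm
  exact Set.disjoint_left.1 (GK_disj k ch K'') hx'' this

lemma Gs_disj {k : ℕ} (hk : 3000 < k) (ch : ℝ × ℝ → Bool) {i m : ℕ} {x : ℝ} (hi : x ∈ Gs k ch i)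
    (hm : x ∈ Gs k ch m) : i = m := by
  have key : ∀ i m, i < m → x ∈ Gs k ch i → x ∈ Gs k ch m → False := by
    intro i m h hi hm
    simp only [Gs, mem_iUnion] at hm
    obtain ⟨K', hK', hx'⟩ := hm
    exact Gs_lt hk ch h hK' (GK_sub hk ch (len_Kfam_pos hK') hx') hi
  rcases lt_trichotomy i m with h | h | h
  · exact (key _ _ h hi hm).elim
  · exact h
  · exact (key _ _ h hm hi).elim

lemma Kfam_finite (k i : ℕ) : (Kfam k i).Finite := by
  induction i with
  | zero => simp [Kfam]
  | succ i ih =>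
    have : Kfam k (i + 1) ⊆ (fun q : (ℝ × ℝ) × ℕ => chd k q.1 q.2) ''
        ((Kfam k i) ×ˢ (Finset.range (3 ^ (k - 1)) : Set ℕ)) := by
      intro I hI
      obtain ⟨K, hK, j, hj, rfl⟩ := (Kfam_succ k i I).1 hI
      exact ⟨(K, j), ⟨hK, by simpa using hj⟩, rfl⟩
    exact ((ih.prod (Finset.finite_toSet _)).image _).subset this

lemma Gs_meas (k : ℕ) (ch : ℝ × ℝ → Bool) (i : ℕ) : MeasurableSet (Gs k ch i) :=
  (Kfam_finite k i).measurableSet_biUnion (fun _ _ => measurableSet_Ico)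

/-! ### Weights -/

/-- Generic weight. -/
def U (k : ℕ) (ch : ℝ × ℝ → Bool) (b : ℝ) (x : ℝ) : ℝ :=
  ∑' i : ℕ, Set.indicator (Gs k ch i) (fun _ => b ^ (i + 1)) x

lemma U_on {k : ℕ} (hk : 3000 < k) (ch : ℝ × ℝ → Bool) (b : ℝ) {i : ℕ} {x : ℝ}
    (hx : x ∈ Gs k ch i) : U k ch b x = b ^ (i + 1) := by
  unfold U
  rw [tsum_eq_single i]
  · simp [hx]
  · intro m hm
    rw [Set.indicator_of_notMem]
    intro h; exact hm (Gs_disj hk ch h hx)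

lemma U_off (k : ℕ) (ch : ℝ × ℝ → Bool) (b : ℝ) {x : ℝ}
    (hx : ∀ i, x ∉ Gs k ch i) : U k ch b x = 0 := by
  unfold U
  simp [hx]

/-- base -/
def aa (k : ℕ) : ℝ := (3 : ℝ) ^ k / ((3 : ℝ) ^ (k - 1) + 1)

lemma wgt_eq {k : ℕ} (hk : 3000 < k) (ch : ℝ × ℝ → Bool) : wgt k ch = U k ch (aa k) := by
  funext x
  unfold wgt U
  congr 1
  funext i
  by_cases hx : x ∈ Gs k ch i
  · have hx0 := hx
    simp only [Gs, mem_iUnion] at hx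
    obtain ⟨K, hK, hxK⟩ := hx
    have hJ : mid K ∈ Jfam k (i + 1) := ⟨K, by simpa using hK, rfl⟩
    rw [tsum_eq_single (⟨mid K, hJ⟩ : ↥(Jfam k (i + 1)))]
    · rw [Set.indicator_of_mem hx0, Set.indicator_of_mem (show x ∈ ivSet (IJ k ch (mid K)) from hxK)]
      rfl
    · rintro ⟨J, K', hK', rfl⟩ hne
      have hK'' : K' ∈ Kfam k i := by simpa using hK'
      rw [Set.indicator_of_notMem]
      intro h
      apply hne
      have := Kfam_unique hk i K hK K' hK'' x (GK_sub hk ch (len_Kfam_pos hK) hxK)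
        (GK_sub hk ch (len_Kfam_pos hK'') h)
      subst this; rfl
  · rw [Set.indicator_of_notMem hx]
    have : ∀ J : ↥(Jfam k (i + 1)), Set.indicator (ivSet (IJ k ch (J : ℝ × ℝ)))
      (fun _ => ((3 : ℝ) ^ k / ((3 : ℝ) ^ (k - 1) + 1)) ^ (i + 1)) x = 0 := by
      rintro ⟨J, K', hK', rfl⟩
      rw [Set.indicator_of_notMem]
      intro h
      apply hx
      simp only [Gs, mem_iUnion]
      exact ⟨K', by simpa using hK', h⟩
    simp only [this, tsum_zero]

lemma aa_ge {k : ℕ} (hk : 3000 < k) : 1 ≤ aa k := by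
  unfold aa
  rw [le_div_iff₀ (by positivity), pow3 hk]
  have : (1 : ℝ) ≤ 3 ^ (k - 1) := one_le_pow₀ (by norm_num)
  linarith

lemma sgm_eq (p : ℝ) {k : ℕ} (hk : 3000 < k) (ch : ℝ × ℝ → Bool) :
    sgm p k ch = U k ch (aa k ^ (1 - p)) := by
  funext x
  have ha : 0 < aa k := lt_of_lt_of_le one_pos (aa_ge hk)
  unfold sgm
  rw [wgt_eq hk]
  by_cases hx : ∃ i, x ∈ Gs k ch i
  · obtain ⟨i, hi⟩ := hx
    rw [U_on hk ch _ hi, U_on hk ch _ hi, if_pos (by positivity)]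
    rw [← Real.rpow_natCast, ← Real.rpow_natCast, ← Real.rpow_mul ha.le, ← Real.rpow_mul ha.le,
      mul_comm]
  · push Not at hx
    rw [U_off _ _ _ hx, U_off _ _ _ hx]; simp

lemma mid_eq_iUnion {k : ℕ} (hk : 3000 < k) {K : ℝ × ℝ} (h : 0 < len K) :
    ivSet (mid K) = ⋃ j ∈ Finset.range (3 ^ (k - 1)), ivSet (chd k K j) := by
  ext x
  simp only [mem_iUnion, Finset.mem_range]
  constructor
  · intro hx
    obtain ⟨j, hj, hx⟩ := mid_cover hk h hx
    exact ⟨j, hj, hx⟩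
  · rintro ⟨j, hj, hx⟩
    exact chd_sub hk h hj hx

lemma ivSet_meas (I : ℝ × ℝ) : MeasurableSet (ivSet I) := measurableSet_Ico

lemma vol_ivSet {I : ℝ × ℝ} (h : I.1 ≤ I.2) : volume.real (ivSet I) = len I := by
  simp [ivSet, len, h]

lemma ivSet_fin (I : ℝ × ℝ) : volume (ivSet I) ≠ ⊤ := by
  simp [ivSet]

lemma inter_fin (A : Set ℝ) (I : ℝ × ℝ) : volume (A ∩ ivSet I) ≠ ⊤ :=
  measure_ne_top_of_subset inter_subset_right (ivSet_fin I)

lemma vol_Gs {k : ℕ} (hk : 3000 < k) (ch : ℝ × ℝ → Bool) (n : ℕ) : ∀ i, ∀ K ∈ Kfam k i,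
    volume.real (Gs k ch (i + n) ∩ ivSet K) =
      ((3 : ℝ) ^ (k - 1)) ^ n * (len K / 3 ^ k) * (1 / 3 ^ k) ^ n := by
  induction n with
  | zero =>
    intro i K hK
    have h0 := len_Kfam_pos hK
    have : Gs k ch (i + 0) ∩ ivSet K = ivSet (GK k ch K) := by
      ext x
      constructor
      · rintro ⟨h1, h2⟩; exact (Gs_eq hk ch hK h2).1 h1
      · intro h; exact ⟨(Gs_eq hk ch hK (GK_sub hk ch h0 h)).2 h, GK_sub hk ch h0 h⟩
    rw [this, vol_ivSet, len_GK]
    · simp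
    · have := len_GK k ch K
      have h1 := (D_small hk h0).1
      simp only [len] at this h1; linarith
  | succ n ih =>
    intro i K hK
    have h0 := len_Kfam_pos hK
    have : Gs k ch (i + (n + 1)) ∩ ivSet K =
        ⋃ j ∈ Finset.range (3 ^ (k - 1)), (Gs k ch (i + 1 + n) ∩ ivSet (chd k K j)) := by
      rw [← inter_iUnion₂, ← mid_eq_iUnion hk h0, show i + (n + 1) = i + 1 + n by ring]
      ext x
      constructor
      · rintro ⟨h1, h2⟩; exact ⟨h1, Gs_gt hk ch (by omega) hK h2 h1⟩
      · rintro ⟨h1, h2⟩; exact ⟨h1, mid_sub h0 h2⟩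
    rw [this, measureReal_biUnion_finset (h := fun j _ => inter_fin _ _)]
    · rw [Finset.sum_congr rfl (fun j hj => ih (i + 1) _ (chd_mem hK (Finset.mem_range.1 hj)))]
      simp only [len_chd, Finset.sum_const, Finset.card_range, nsmul_eq_mul]
      push_cast
      ring
    · intro j _ j' _ hne
      exact (chd_disj hk h0 hne).mono inter_subset_right inter_subset_right
    · intro j _; exact (Gs_meas k ch _).inter (ivSet_meas _)

/-- The properties of the weights used in the proof. -/
structure Good (k : ℕ) (ch : ℝ × ℝ → Bool) (u : ℝ → ℝ) (b M : ℝ) : Prop where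
  bpos : 0 < b
  M0 : 0 ≤ M
  M1 : M ≤ 1
  nonneg : ∀ x, 0 ≤ u x
  int : Integrable u
  onG : ∀ i, ∀ K ∈ Kfam k i, ∀ x ∈ ivSet (GK k ch K), u x = b ^ (i + 1)
  off : ∀ i, ∀ K ∈ Kfam k i, ∀ x ∈ ivSet K, x ∉ ivSet (mid K) → x ∉ ivSet (GK k ch K) → u x = 0
  mass : ∀ i, ∀ K ∈ Kfam k i, ∫ x in ivSet K, u x = M * b ^ i * len K

lemma U_sum {k : ℕ} (hk : 3000 < k) (ch : ℝ × ℝ → Bool) {b : ℝ} (hb : 0 < b)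
    (hb1 : b * 3 ^ (k - 1) / 3 ^ k < 1) {i : ℕ} {K : ℝ × ℝ} (hK : K ∈ Kfam k i) :
    HasSum (fun m => ∫ x in ivSet K, Set.indicator (Gs k ch m) (fun _ => b ^ (m + 1)) x)
      ((b / 3 ^ k / (1 - b * 3 ^ (k - 1) / 3 ^ k)) * b ^ i * len K) := by
  have hval : ∀ m, ∫ x in ivSet K, Set.indicator (Gs k ch m) (fun _ => b ^ (m + 1)) x =
      volume.real (Gs k ch m ∩ ivSet K) * b ^ (m + 1) := by
    intro m
    rw [setIntegral_indicator (Gs_meas k ch m), setIntegral_const, smul_eq_mul, inter_comm]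
  simp only [hval]
  have hinj : Function.Injective (fun n => i + n) := add_right_injective i
  rw [← hinj.hasSum_iff]
  · have h := (hasSum_geometric_of_lt_one (r := b * 3 ^ (k - 1) / 3 ^ k) (by positivity) hb1).mul_left
      (b ^ i * len K * (b / 3 ^ k))
    have e1 : ((fun m => volume.real (Gs k ch m ∩ ivSet K) * b ^ (m + 1)) ∘ fun n => i + n) =
        fun n => b ^ i * len K * (b / 3 ^ k) * (b * 3 ^ (k - 1) / 3 ^ k) ^ n := by
      funext n
      simp only [Function.comp]
      rw [vol_Gs hk ch n i K hK]
      simp only [div_pow, mul_pow, one_pow]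
      ring
    have e2 : b / 3 ^ k / (1 - b * 3 ^ (k - 1) / 3 ^ k) * b ^ i * len K =
        b ^ i * len K * (b / 3 ^ k) * (1 - b * 3 ^ (k - 1) / 3 ^ k)⁻¹ := by
      rw [div_eq_mul_inv (b / 3 ^ k)]; ring
    rw [e1, e2]; exact h
  · intro m hm
    have hmi : m < i := by
      by_contra h
      exact hm ⟨m - i, by simp; omega⟩
    have : Gs k ch m ∩ ivSet K = ∅ := by
      ext x; simp only [mem_inter_iff, mem_empty_iff_false, iff_false, not_and]
      intro h1 h2; exact Gs_lt hk ch hmi hK h2 h1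
    rw [this]; simp

lemma U_nonneg (k : ℕ) (ch : ℝ × ℝ → Bool) {b : ℝ} (hb : 0 < b) (x : ℝ) : 0 ≤ U k ch b x := by
  apply tsum_nonneg
  intro i
  exact Set.indicator_nonneg (fun _ _ => by positivity) _

lemma ind_int (k : ℕ) (ch : ℝ × ℝ → Bool) (b : ℝ) (K : ℝ × ℝ) (m : ℕ) :
    Integrable (Set.indicator (Gs k ch m) (fun _ => b ^ (m + 1))) (volume.restrict (ivSet K)) := by
  apply Integrable.indicator _ (Gs_meas k ch m)
  have : IsFiniteMeasure (volume.restrict (ivSet K)) :=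
    ⟨by rw [Measure.restrict_apply_univ]; exact (ivSet_fin K).lt_top⟩
  exact integrable_const _

lemma U_measurable {k : ℕ} (hk : 3000 < k) (ch : ℝ × ℝ → Bool) (b : ℝ) : Measurable (U k ch b) := by
  refine measurable_of_tendsto_metrizable (f := fun n x =>
    ∑ i ∈ Finset.range n, Set.indicator (Gs k ch i) (fun _ => b ^ (i + 1)) x) ?_ ?_
  · intro n
    exact Finset.measurable_sum _ (fun i _ => (measurable_const.indicator (Gs_meas k ch i)))
  · rw [tendsto_pi_nhds]
    intro x
    have hs : Summable (fun i => Set.indicator (Gs k ch i) (fun _ => b ^ (i + 1)) x) := by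
      by_cases hx : ∃ i, x ∈ Gs k ch i
      · obtain ⟨i, hi⟩ := hx
        apply summable_of_ne_finset_zero (s := {i})
        intro m hm
        rw [Set.indicator_of_notMem]
        intro h; exact hm (by simp [Gs_disj hk ch h hi])
      · push Not at hx
        simp [hx, summable_zero]
    exact hs.hasSum.tendsto_sum_nat

lemma U_good {k : ℕ} (hk : 3000 < k) (ch : ℝ × ℝ → Bool) {b : ℝ} (hb : 0 < b)
    (hb1 : b * 3 ^ (k - 1) / 3 ^ k < 1)
    (hM : b / 3 ^ k / (1 - b * 3 ^ (k - 1) / 3 ^ k) ≤ 1) :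
    Good k ch (U k ch b) b (b / 3 ^ k / (1 - b * 3 ^ (k - 1) / 3 ^ k)) where
  bpos := hb
  M0 := by
    have : 0 < 1 - b * 3 ^ (k - 1) / 3 ^ k := by linarith
    positivity
  M1 := hM
  nonneg := U_nonneg k ch hb
  int := by
    have h0 : ((0 : ℝ), (1 : ℝ)) ∈ Kfam k 0 := by simp [Kfam]
    have hs := U_sum hk ch hb hb1 h0
    set K : ℝ × ℝ := ((0 : ℝ), (1 : ℝ)) with hKdef
    have hon : IntegrableOn (U k ch b) (ivSet K) := by
      refine ⟨(U_measurable hk ch b).aestronglyMeasurable, ?_⟩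
      rw [hasFiniteIntegral_iff_ofReal (Eventually.of_forall (U_nonneg k ch hb))]
      have h1 : ∀ x, ENNReal.ofReal (U k ch b x) =
          ∑' i, ENNReal.ofReal (Set.indicator (Gs k ch i) (fun _ => b ^ (i + 1)) x) := by
        intro x
        unfold U
        apply ENNReal.ofReal_tsum_of_nonneg
        · intro i; exact Set.indicator_nonneg (fun _ _ => by positivity) _
        · by_cases hx : ∃ i, x ∈ Gs k ch i
          · obtain ⟨i, hi⟩ := hx
            apply summable_of_ne_finset_zero (s := {i})
            intro m hm
            rw [Set.indicator_of_notMem]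
            intro h; exact hm (by simp [Gs_disj hk ch h hi])
          · push Not at hx
            simp [hx, summable_zero]
      simp only [h1]
      rw [lintegral_tsum]
      · have h2 : ∀ i, ∫⁻ x in ivSet K, ENNReal.ofReal (Set.indicator (Gs k ch i) (fun _ => b ^ (i + 1)) x)
            = ENNReal.ofReal (∫ x in ivSet K, Set.indicator (Gs k ch i) (fun _ => b ^ (i + 1)) x) := by
          intro i
          rw [ofReal_integral_eq_lintegral_ofReal (ind_int k ch b K i)]
          exact Eventually.of_forall (fun x => Set.indicator_nonneg (fun _ _ => by positivity) _)
        simp only [h2]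
        rw [← ENNReal.ofReal_tsum_of_nonneg _ hs.summable]
        · exact ENNReal.ofReal_lt_top
        · intro i
          exact integral_nonneg (fun x => Set.indicator_nonneg (fun _ _ => by positivity) _)
      · intro i
        exact ((measurable_const.indicator (Gs_meas k ch i)).ennreal_ofReal).aemeasurable
    rw [← integrableOn_univ]
    have : U k ch b = Set.indicator (ivSet K) (U k ch b) := by
      funext x
      by_cases hx : x ∈ ivSet K
      · rw [Set.indicator_of_mem hx]
      · rw [Set.indicator_of_notMem hx]
        apply U_off
        intro i hi
        apply hx
        simp only [Gs, mem_iUnion] at hi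
        obtain ⟨K', hK', hx'⟩ := hi
        have hx'' := GK_sub hk ch (len_Kfam_pos hK') hx'
        rcases i with _ | i
        · simp only [Kfam, mem_singleton_iff] at hK'; rw [hKdef, ← hK']; exact hx''
        · have hK2 : K' ∈ Kfam k (0 + i + 1) := by rw [zero_add]; exact hK'
          obtain ⟨K2, hK2, h2⟩ := Kfam_anc hk 0 i K' hK2 x hx''
          have h3 := mid_sub (len_Kfam_pos hK2) h2
          simp only [Kfam, mem_singleton_iff] at hK2; rw [hKdef, ← hK2]; exact h3
    rw [this, integrableOn_univ, integrable_indicator_iff (ivSet_meas K)]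
    exact hon
  onG := by
    intro i K hK x hx
    exact U_on hk ch b ((Gs_eq hk ch hK (GK_sub hk ch (len_Kfam_pos hK) hx)).2 hx)
  off := by
    intro i K hK x hx h1 h2
    apply U_off
    intro m hm
    rcases lt_trichotomy i m with h | h | h
    · exact h1 (Gs_gt hk ch h hK hx hm)
    · subst h; exact h2 ((Gs_eq hk ch hK hx).1 hm)
    · exact Gs_lt hk ch h hK hx hm
  mass := by
    intro i K hK
    have hs := U_sum hk ch hb hb1 hK
    have := hasSum_integral_of_summable_integral_norm (μ := volume.restrict (ivSet K))
      (F := fun m => Set.indicator (Gs k ch m) (fun _ => b ^ (m + 1)))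
      (fun m => ind_int k ch b K m) (by
        convert hs.summable using 1
        funext m
        congr 1
        funext x
        rw [Real.norm_of_nonneg]
        exact Set.indicator_nonneg (fun _ _ => by positivity) _)
    exact this.unique hs

lemma w_good {k : ℕ} (hk : 3000 < k) (ch : ℝ × ℝ → Bool) : Good k ch (wgt k ch) (aa k) 1 := by
  have ha : 0 < aa k := lt_of_lt_of_le one_pos (aa_ge hk)
  have hN : (0 : ℝ) < 3 ^ (k - 1) := by positivity
  have e1 : aa k * 3 ^ (k - 1) / 3 ^ k = 3 ^ (k - 1) / (3 ^ (k - 1) + 1) := by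
    unfold aa; field_simp
  have e2 : aa k / 3 ^ k / (1 - aa k * 3 ^ (k - 1) / 3 ^ k) = 1 := by
    rw [e1]; unfold aa; field_simp; simp
  have := U_good hk ch ha (by rw [e1, div_lt_one (by positivity)]; linarith) e2.le
  rw [e2] at this
  rw [wgt_eq hk]; exact this

lemma s_good {p : ℝ} (hp : 1 < p) {k : ℕ} (hk : 3000 < k) (ch : ℝ × ℝ → Bool) :
    ∃ M, M ≤ 2 / 3 ^ k ∧ Good k ch (sgm p k ch) (aa k ^ (1 - p)) M := by
  have ha : 0 < aa k := lt_of_lt_of_le one_pos (aa_ge hk)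
  have hb : 0 < aa k ^ (1 - p) := Real.rpow_pos_of_pos ha _
  have hb1 : aa k ^ (1 - p) ≤ 1 := Real.rpow_le_one_of_one_le_of_nonpos (aa_ge hk) (by linarith)
  set b := aa k ^ (1 - p)
  have e1 : b * 3 ^ (k - 1) / 3 ^ k ≤ 1 / 3 := by
    rw [pow3 hk, div_le_iff₀ (by positivity)]
    have : (0 : ℝ) < 3 ^ (k - 1) := by positivity
    nlinarith
  have h3 := pow3_ge hk
  have hM : b / 3 ^ k / (1 - b * 3 ^ (k - 1) / 3 ^ k) ≤ 2 / 3 ^ k := by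
    rw [div_le_iff₀ (by linarith)]
    have : b / 3 ^ k ≤ 1 / 3 ^ k := by gcongr
    have h2 : (2 : ℝ) / 3 ^ k * (2 / 3) ≤ 2 / 3 ^ k * (1 - b * 3 ^ (k - 1) / 3 ^ k) := by
      gcongr; linarith
    have h4 : (2 : ℝ) / 3 ^ k * (2 / 3) = (1 / 3 ^ k) * (4 / 3) := by ring
    have h5 : (0 : ℝ) < 1 / 3 ^ k := by positivity
    linarith
  refine ⟨_, hM, ?_⟩
  rw [sgm_eq p hk]
  refine U_good hk ch hb (by linarith) (hM.trans ?_)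
  rw [div_le_one (by positivity)]; linarith

/-! ### Sparse families -/

/-- A finite Carleson family. -/
def CF (θ : ℝ) (F : Finset (ℝ × ℝ)) (Es : ℝ × ℝ → Set ℝ) : Prop :=
  (∀ I ∈ F, I.1 < I.2 ∧ MeasurableSet (Es I) ∧ Es I ⊆ ivSet I ∧ θ * len I ≤ volume.real (Es I)) ∧
    (F : Set (ℝ × ℝ)).PairwiseDisjoint Es

lemma CF.mono {θ : ℝ} {F F' : Finset (ℝ × ℝ)} {Es : ℝ × ℝ → Set ℝ} (h : CF θ F Es) (hF : F' ⊆ F) :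
    CF θ F' Es :=
  ⟨fun I hI => h.1 I (hF hI), h.2.subset (by exact_mod_cast hF)⟩

lemma master {θ : ℝ} {F : Finset (ℝ × ℝ)} {Es : ℝ × ℝ → Set ℝ} (hF : CF θ F Es)
    (φ : ℝ × ℝ → ℝ) (h : ℝ → ℝ) (hφ : ∀ I ∈ F, 0 ≤ φ I) (h0 : ∀ x, 0 ≤ h x) (hi : Integrable h)
    (hle : ∀ I ∈ F, ∀ x ∈ ivSet I, φ I ≤ h x) :
    θ * ∑ I ∈ F, φ I * len I ≤ ∫ x, h x := by
  calc θ * ∑ I ∈ F, φ I * len I = ∑ I ∈ F, φ I * (θ * len I) := by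
        rw [Finset.mul_sum]; exact Finset.sum_congr rfl (fun I _ => by ring)
    _ ≤ ∑ I ∈ F, ∫ x in Es I, h x := by
        apply Finset.sum_le_sum
        intro I hI
        obtain ⟨h1, h2, h3, h4⟩ := hF.1 I hI
        have hfin : volume (Es I) ≠ ⊤ := measure_ne_top_of_subset h3 (ivSet_fin I)
        calc φ I * (θ * len I) ≤ φ I * volume.real (Es I) :=
              mul_le_mul_of_nonneg_left h4 (hφ I hI)
          _ = ∫ x in Es I, φ I := by rw [setIntegral_const, smul_eq_mul, mul_comm]
          _ ≤ ∫ x in Es I, h x := by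
              apply setIntegral_mono_on _ hi.integrableOn h2 (fun x hx => hle I hI x (h3 hx))
              exact integrableOn_const hfin
    _ = ∫ x in ⋃ I ∈ F, Es I, h x := by
        rw [integral_biUnion_finset F (fun I hI => (hF.1 I hI).2.1) hF.2
          (fun I _ => hi.integrableOn)]
    _ ≤ ∫ x, h x := setIntegral_le_integral hi (Eventually.of_forall h0)

/-- relative size -/
def rel (I : ℝ × ℝ) (A : Set ℝ) : ℝ := volume.real (ivSet I ∩ A) / len I

lemma rel_nonneg {I : ℝ × ℝ} (hI : I.1 < I.2) (A : Set ℝ) : 0 ≤ rel I A :=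
  div_nonneg measureReal_nonneg (by simp only [len]; linarith)

lemma rel_le_one {I : ℝ × ℝ} (hI : I.1 < I.2) (A : Set ℝ) : rel I A ≤ 1 := by
  unfold rel
  have h : 0 < len I := by simp only [len]; linarith
  rw [div_le_one h, ← vol_ivSet hI.le]
  exact measureReal_mono inter_subset_left (ivSet_fin I)

lemma rel_ker {I E : ℝ × ℝ} (hI : I.1 < I.2) (hE : E.1 < E.2) {x : ℝ} (hx : x ∈ ivSet I) :
    rel I (ivSet E) ≤ 3 * (1 + ‖(x - E.1) / len E‖)⁻¹ := by
  have hI' : 0 < len I := by simp only [len]; linarith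
  have hE' : 0 < len E := by simp only [len]; linarith
  have hrhs : 3 * (1 + ‖(x - E.1) / len E‖)⁻¹ = 3 * len E / (len E + |x - E.1|) := by
    rw [Real.norm_eq_abs, abs_div, abs_of_pos hE']; field_simp
  rw [hrhs]
  have hpos : 0 < len E + |x - E.1| := by positivity
  by_cases hne : (ivSet I ∩ ivSet E).Nonempty
  · obtain ⟨y, hyI, hyE⟩ := hne
    have hd : |x - E.1| ≤ len I + len E := by
      simp only [ivSet, mem_Ico, len] at *
      rw [abs_le]; constructor <;> linarith
    by_cases hc : len E ≤ len I
    · have h1 : rel I (ivSet E) ≤ len E / len I := by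
        unfold rel
        gcongr
        rw [← vol_ivSet hE.le]
        exact measureReal_mono inter_subset_right (ivSet_fin E)
      refine h1.trans ?_
      rw [div_le_div_iff₀ hI' hpos]
      nlinarith
    · refine (rel_le_one hI _).trans ?_
      rw [le_div_iff₀ hpos]; linarith
  · rw [not_nonempty_iff_eq_empty] at hne
    unfold rel; rw [hne]; simp; positivity

/-- kernel constant -/
def Cs (s : ℝ) : ℝ := 3 ^ s * ∫ x : ℝ, (1 + ‖x‖) ^ (-s)

lemma Cs_nonneg (s : ℝ) : 0 ≤ Cs s := by
  unfold Cs
  have : 0 ≤ ∫ x : ℝ, (1 + ‖x‖) ^ (-s) := integral_nonneg (fun x => by positivity)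
  positivity

lemma sum_pow {θ : ℝ} {F : Finset (ℝ × ℝ)} {Es : ℝ × ℝ → Set ℝ} (hF : CF θ F Es)
    {s : ℝ} (hs : 1 < s) (E : ℝ × ℝ) :
    θ * ∑ I ∈ F, rel I (ivSet E) ^ s * len I ≤ Cs s * volume.real (ivSet E) := by
  by_cases hE : E.1 < E.2
  · have hE' : 0 < len E := by simp only [len]; linarith
    have hgint : Integrable (fun x : ℝ => (1 + ‖x‖) ^ (-s)) :=
      integrable_one_add_norm (by simpa using hs)
    set g : ℝ → ℝ := fun x => (1 + ‖x‖) ^ (-s)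
    have hgint2 : Integrable (fun x => 3 ^ s * g ((x - E.1) / len E)) :=
      (((hgint.comp_div hE'.ne').comp_sub_right E.1).const_mul _)
    have hm := master hF (fun I => rel I (ivSet E) ^ s) (fun x => 3 ^ s * g ((x - E.1) / len E))
      (fun I hI => Real.rpow_nonneg (rel_nonneg (hF.1 I hI).1 _) _)
      (fun x => by simp only [g]; positivity) hgint2 (by
        intro I hI x hx
        have h1 := rel_ker (hF.1 I hI).1 hE hx
        calc rel I (ivSet E) ^ s ≤ (3 * (1 + ‖(x - E.1) / len E‖)⁻¹) ^ s :=
              Real.rpow_le_rpow (rel_nonneg (hF.1 I hI).1 _) h1 (by linarith)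
          _ = _ := by
              simp only [g]
              rw [Real.mul_rpow (by norm_num) (by positivity), Real.inv_rpow (by positivity),
                Real.rpow_neg (by positivity)])
    refine hm.trans (le_of_eq ?_)
    rw [integral_const_mul, integral_sub_right_eq_self (fun x => g (x / len E)),
      Measure.integral_comp_div, vol_ivSet hE.le, smul_eq_mul, abs_of_pos hE']
    unfold Cs; ring
  · have : ivSet E = ∅ := by simp only [ivSet]; exact Ico_eq_empty hE
    have h2 : ∀ I, rel I (ivSet E) ^ s = 0 := by
      intro I; unfold rel; rw [this]; simp; exact Real.zero_rpow (by linarith)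
    simp only [h2, zero_mul, Finset.sum_const_zero, mul_zero]
    rw [this]; simp

lemma int_log {X : ℝ} (hX : 0 ≤ X) (c d : ℝ) (hd : 0 < d) :
    ∫ x in Icc (c - X) (c + X), 3 * (1 + ‖(x - c) / d‖)⁻¹ = 6 * d * Real.log (1 + X / d) := by
  rw [integral_Icc_eq_integral_Ioc, ← intervalIntegral.integral_of_le (by linarith)]
  rw [← intervalIntegral.integral_add_adjacent_intervals (b := c)]
  · have h1 : ∫ x in c..c + X, 3 * (1 + ‖(x - c) / d‖)⁻¹ = 3 * d * Real.log (1 + X / d) := by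
      rw [intervalIntegral.integral_eq_sub_of_hasDerivAt
        (f := fun x => 3 * d * Real.log (1 + (x - c) / d))]
      · simp
      · intro x hx
        rw [uIcc_of_le (by linarith)] at hx
        have hy : 0 ≤ (x - c) / d := div_nonneg (by linarith [hx.1]) hd.le
        have h2 : HasDerivAt (fun x : ℝ => 1 + (x - c) / d) (1 / d) x :=
          (((hasDerivAt_id x).sub_const c).div_const d).const_add 1
        have h4 := (h2.log (by positivity)).const_mul (3 * d)
        have h5 : 3 * (1 + ‖(x - c) / d‖)⁻¹ = 3 * d * (1 / d / (1 + (x - c) / d)) := by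
          rw [Real.norm_of_nonneg hy]; field_simp
        rw [h5]; exact h4
      · apply Continuous.intervalIntegrable
        have : ∀ x : ℝ, 1 + ‖(x - c) / d‖ ≠ 0 := fun x => by positivity
        fun_prop (disch := assumption)
    have h1' : ∫ x in c - X..c, 3 * (1 + ‖(x - c) / d‖)⁻¹ = 3 * d * Real.log (1 + X / d) := by
      rw [intervalIntegral.integral_eq_sub_of_hasDerivAt
        (f := fun x => - (3 * d * Real.log (1 - (x - c) / d)))]
      · simp; left; congr 1; ring
      · intro x hx
        rw [uIcc_of_le (by linarith)] at hx
        have hy : (x - c) / d ≤ 0 := div_nonpos_of_nonpos_of_nonneg (by linarith [hx.2]) hd.le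
        have h2 : HasDerivAt (fun x : ℝ => 1 - (x - c) / d) (-(1 / d)) x :=
          (((hasDerivAt_id x).sub_const c).div_const d).const_sub 1
        have h3 : 1 - (x - c) / d ≠ 0 := by linarith
        have h4 := ((h2.log h3).const_mul (3 * d)).neg
        have h5 : 3 * (1 + ‖(x - c) / d‖)⁻¹ = -(3 * d * (-(1 / d) / (1 - (x - c) / d))) := by
          rw [Real.norm_of_nonpos hy, ← sub_eq_add_neg]; field_simp
        rw [h5]; exact h4
      · apply Continuous.intervalIntegrable
        have : ∀ x : ℝ, 1 + ‖(x - c) / d‖ ≠ 0 := fun x => by positivity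
        fun_prop (disch := assumption)
    rw [h1, h1']; ring
  all_goals
    apply Continuous.intervalIntegrable
    have : ∀ x : ℝ, 1 + ‖(x - c) / d‖ ≠ 0 := fun x => by positivity
    fun_prop (disch := assumption)

lemma sum_cross {k : ℕ} (hk : 3000 < k) {θ : ℝ} {F : Finset (ℝ × ℝ)} {Es : ℝ × ℝ → Set ℝ} (hF : CF θ F Es)
    {E K : ℝ × ℝ} (hK : 0 < len K) (hE : len E = len K / 3 ^ k) (hEK : ivSet E ⊆ ivSet K)
    (hIK : ∀ I ∈ F, ivSet I ⊆ ivSet K) :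
    θ * ∑ I ∈ F, rel I (ivSet E) * len I ≤ 18 * k * len E := by
  have hE' : 0 < len E := by rw [hE]; positivity
  have hEl : E.1 < E.2 := by simp only [len] at hE'; linarith
  have hE1 : E.1 ∈ ivSet K := hEK ⟨le_rfl, hEl⟩
  have hcont : Continuous (fun x => 3 * (1 + ‖(x - E.1) / len E‖)⁻¹) := by
    have : ∀ x : ℝ, 1 + ‖(x - E.1) / len E‖ ≠ 0 := fun x => by positivity
    fun_prop (disch := assumption)
  have hm := master hF (fun I => rel I (ivSet E))
    (Set.indicator (Icc (E.1 - len K) (E.1 + len K)) (fun x => 3 * (1 + ‖(x - E.1) / len E‖)⁻¹))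
    (fun I hI => rel_nonneg (hF.1 I hI).1 _)
    (fun x => Set.indicator_nonneg (fun _ _ => by positivity) _)
    ((integrable_indicator_iff measurableSet_Icc).2 hcont.integrableOn_Icc)
    (by
      intro I hI x hx
      have hxK := hIK I hI hx
      rw [Set.indicator_of_mem]
      · exact rel_ker (hF.1 I hI).1 hEl hx
      · simp only [ivSet, mem_Ico, len, mem_Icc] at *
        constructor <;> linarith)
  refine hm.trans ?_
  rw [integral_indicator measurableSet_Icc, int_log hK.le _ _ hE']
  have e : len K / len E = 3 ^ k := by rw [hE]; field_simp
  rw [e]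
  have hlog : Real.log (1 + 3 ^ k) ≤ 3 * k := by
    have h1 : (1 : ℝ) + 3 ^ k ≤ 3 ^ (k + 1) := by
      have := pow3_ge hk
      rw [pow_succ]; linarith
    have h2 := Real.log_le_log (by positivity) h1
    rw [Real.log_pow] at h2
    have h3 : Real.log 3 ≤ 2 := by
      have := Real.log_le_sub_one_of_pos (show (0 : ℝ) < 3 by norm_num); linarith
    have hk' : (2 : ℝ) ≤ k := by exact_mod_cast (by omega : 2 ≤ k)
    push_cast at h2
    nlinarith
  nlinarith

/-! ### Local estimates -/

lemma vol_inter_ge {I K : ℝ × ℝ} {s t : ℝ} (h : s ≤ t) (hs : Ico s t ⊆ ivSet I ∩ ivSet K) :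
    t - s ≤ volume.real (ivSet I ∩ ivSet K) := by
  have := measureReal_mono (μ := volume) hs (inter_fin _ _)
  simpa [h] using this

lemma u_zero_small {k : ℕ} (hk : 3000 < k) {ch : ℝ × ℝ → Bool} {u : ℝ → ℝ} {b M : ℝ}
    (hu : Good k ch u b M) {i : ℕ} {K : ℝ × ℝ} (hK : K ∈ Kfam k i) {I : ℝ × ℝ}
    (hI : ¬ ivSet I ⊆ ivSet K) (hs : volume.real (ivSet I ∩ ivSet K) < len K / 4) :
    ∫ x in ivSet I ∩ ivSet K, u x = 0 := by
  have hl := len_Kfam_pos hK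
  have hD := D_small hk hl
  have hz : ∀ x ∈ ivSet I ∩ ivSet K, u x = 0 := by
    intro x hx
    have hx0 := hx
    obtain ⟨y, hyI, hyK⟩ := not_subset.1 hI
    have hmain : x < K.1 + len K / 4 ∨ K.1 + 3 * len K / 4 < x := by
      simp only [ivSet, mem_inter_iff, mem_Ico, not_and, not_lt] at hyI hyK hx
      have h2 := snd_eq K
      by_cases hy : K.1 ≤ y
      · right
        have hy2 := hyK hy
        have := vol_inter_ge (I := I) (K := K) (s := x) (t := K.2) (by linarith) (by
          intro z hz
          simp only [ivSet, mem_inter_iff, mem_Ico] at *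
          refine ⟨⟨by linarith, by linarith⟩, by linarith, by linarith⟩)
        linarith
      · left
        have := vol_inter_ge (I := I) (K := K) (s := K.1) (t := x) (by linarith) (by
          intro z hz
          simp only [ivSet, mem_inter_iff, mem_Ico] at *
          refine ⟨⟨by linarith, by linarith⟩, by linarith, by linarith⟩)
        linarith
    apply hu.off i K hK x hx0.2
    · simp only [ivSet, mem_Ico, mid_fst, mid_snd]
      rintro ⟨h1, h2⟩
      rcases hmain with h | h <;> linarith
    · simp only [ivSet, mem_Ico]
      rintro ⟨h1, h2⟩
      rcases GK_cases k ch K with h' | h' <;> rw [h'.1] at h1 <;> rw [h'.2] at h2 <;>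
        rcases hmain with h | h <;> linarith
  rw [setIntegral_congr_fun ((ivSet_meas I).inter (ivSet_meas K)) hz]
  simp

lemma int_mono {u : ℝ → ℝ} (hu : ∀ x, 0 ≤ u x) (hi : Integrable u) {A B : Set ℝ} (h : A ⊆ B) :
    ∫ x in A, u x ≤ ∫ x in B, u x :=
  setIntegral_mono_set hi.integrableOn (Eventually.of_forall hu) (Eventually.of_forall h)

lemma int_nn {u : ℝ → ℝ} (hu : ∀ x, 0 ≤ u x) (A : Set ℝ) :
    0 ≤ ∫ x in A, u x := integral_nonneg hu

lemma u_end {k : ℕ} (hk : 3000 < k) {ch : ℝ × ℝ → Bool} {u : ℝ → ℝ} {b M : ℝ}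
    (hu : Good k ch u b M) {i : ℕ} {K : ℝ × ℝ} (hK : K ∈ Kfam k i) {I : ℝ × ℝ}
    (hI : ¬ ivSet I ⊆ ivSet K) :
    ∫ x in ivSet I ∩ ivSet K, u x ≤ 4 * M * b ^ i * volume.real (ivSet I ∩ ivSet K) := by
  have hb := hu.bpos
  have hM := hu.M0
  by_cases hs : volume.real (ivSet I ∩ ivSet K) < len K / 4
  · rw [u_zero_small hk hu hK hI hs]; positivity
  · push Not at hs
    calc ∫ x in ivSet I ∩ ivSet K, u x ≤ ∫ x in ivSet K, u x :=
          int_mono hu.nonneg hu.int inter_subset_right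
      _ = M * b ^ i * len K := hu.mass i K hK
      _ = 4 * M * b ^ i * (len K / 4) := by ring
      _ ≤ _ := by gcongr

lemma split_int {k : ℕ} (hk : 3000 < k) {ch : ℝ × ℝ → Bool} {u : ℝ → ℝ} {b M : ℝ}
    (hu : Good k ch u b M) {i : ℕ} {K : ℝ × ℝ} (hK : K ∈ Kfam k i) {A : Set ℝ}
    (hA : MeasurableSet A) (hAK : A ⊆ ivSet K) :
    ∫ x in A, u x = (∑ j ∈ Finset.range (3 ^ (k - 1)), ∫ x in A ∩ ivSet (chd k K j), u x)
      + b ^ (i + 1) * volume.real (A ∩ ivSet (GK k ch K)) := by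
  have hl := len_Kfam_pos hK
  have hd := GK_disj k ch K
  have h1 : ∫ x in A, u x = ∫ x in (A ∩ ivSet (mid K)) ∪ (A ∩ ivSet (GK k ch K)), u x := by
    apply setIntegral_eq_of_subset_of_forall_sdiff_eq_zero hA
    · exact union_subset inter_subset_left inter_subset_left
    · rintro x ⟨hx, hx'⟩
      simp only [mem_union, mem_inter_iff, hx, true_and, not_or] at hx'
      exact hu.off i K hK x (hAK hx) hx'.1 hx'.2
  have h2 : ∫ x in A ∩ ivSet (GK k ch K), u x = b ^ (i + 1) * volume.real (A ∩ ivSet (GK k ch K)) := by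
    rw [setIntegral_congr_fun (g := fun _ => b ^ (i + 1)) (hA.inter (ivSet_meas _))
      (fun x hx => hu.onG i K hK x hx.2)]
    rw [setIntegral_const, smul_eq_mul, mul_comm]
  have h3 : ∫ x in A ∩ ivSet (mid K), u x =
      ∑ j ∈ Finset.range (3 ^ (k - 1)), ∫ x in A ∩ ivSet (chd k K j), u x := by
    rw [mid_eq_iUnion hk hl, inter_iUnion₂]
    apply integral_biUnion_finset
    · intro j _; exact hA.inter (ivSet_meas _)
    · intro j _ j' _ hne
      exact (chd_disj hk hl hne).mono inter_subset_right inter_subset_right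
    · intro j _; exact hu.int.integrableOn
  rw [h1, setIntegral_union (hd.mono inter_subset_right inter_subset_right)
    (hA.inter (ivSet_meas _)) hu.int.integrableOn hu.int.integrableOn, h2, h3]

lemma vol_split {k : ℕ} (hk : 3000 < k) {K : ℝ × ℝ} (hl : 0 < len K) {A : Set ℝ}
    (hA : MeasurableSet A) :
    volume.real (A ∩ ivSet (mid K)) =
      ∑ j ∈ Finset.range (3 ^ (k - 1)), volume.real (A ∩ ivSet (chd k K j)) := by
  rw [mid_eq_iUnion hk hl, inter_iUnion₂]
  rw [measureReal_biUnion_finset (h := fun j _ => inter_fin _ _)]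
  · intro j _ j' _ hne
    exact (chd_disj hk hl hne).mono inter_subset_right inter_subset_right
  · intro j _; exact hA.inter (ivSet_meas _)

lemma u_class {k : ℕ} (hk : 3000 < k) {ch : ℝ × ℝ → Bool} {u : ℝ → ℝ} {b M : ℝ}
    (hu : Good k ch u b M) {i : ℕ} {K : ℝ × ℝ} (hK : K ∈ Kfam k i) {I : ℝ × ℝ}
    (hIK : ivSet I ⊆ ivSet K) (hI : ∀ j < 3 ^ (k - 1), ¬ ivSet I ⊆ ivSet (chd k K j)) :
    ∫ x in ivSet I, u x ≤ b ^ (i + 1) * (4 * M * volume.real (ivSet I ∩ ivSet (mid K)) +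
      volume.real (ivSet I ∩ ivSet (GK k ch K))) := by
  rw [split_int hk hu hK (ivSet_meas I) hIK, vol_split hk (len_Kfam_pos hK) (ivSet_meas I), mul_add]
  gcongr
  rw [Finset.mul_sum, Finset.mul_sum]
  apply Finset.sum_le_sum
  intro j hj
  have hj' := Finset.mem_range.1 hj
  have := u_end hk hu (chd_mem hK hj') (hI j hj')
  linarith

lemma avg_class {k : ℕ} (hk : 3000 < k) {ch : ℝ × ℝ → Bool} {u : ℝ → ℝ} {b M : ℝ}
    (hu : Good k ch u b M) {i : ℕ} {K : ℝ × ℝ} (hK : K ∈ Kfam k i) {I : ℝ × ℝ} (hlt : I.1 < I.2)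
    (hIK : ivSet I ⊆ ivSet K) (hI : ∀ j < 3 ^ (k - 1), ¬ ivSet I ⊆ ivSet (chd k K j)) :
    avg u I ≤ b ^ (i + 1) * (4 * M * rel I (ivSet (mid K)) + rel I (ivSet (GK k ch K))) := by
  have hl : 0 < len I := by simp only [len]; linarith
  have := u_class hk hu hK hIK hI
  unfold avg mass rel
  rw [div_le_iff₀ hl]
  refine this.trans (le_of_eq ?_)
  field_simp

lemma avg_nonneg {u : ℝ → ℝ} (hu : ∀ x, 0 ≤ u x) {I : ℝ × ℝ} (hlt : I.1 < I.2) : 0 ≤ avg u I :=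
  div_nonneg (int_nn hu _) (by simp only [len]; linarith)

lemma pt_ineq {q x g m n : ℝ} (hq : 1 < q) (hx : 0 ≤ x) (hx1 : x ≤ 1) (hg : 0 ≤ g) (hg1 : g ≤ 1)
    (hm : 0 ≤ m) (hn : 0 ≤ n) (hn1 : n ≤ 1) :
    (4 * m * x + g) ^ q * (4 * n * x + g) ≤
      2 ^ q * 4 ^ q * 4 * (m ^ q * n * x ^ q + m ^ q * (x ^ q * g) + 2 * g ^ q) := by
  have h1 : (4 * m * x + g) ^ q ≤ 2 ^ q * ((4 * m * x) ^ q + g ^ q) := by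
    have hs : 0 ≤ 4 * m * x := by positivity
    rcases le_total (4 * m * x) g with h | h
    · calc (4 * m * x + g) ^ q ≤ (2 * g) ^ q := Real.rpow_le_rpow (by positivity) (by linarith) (by linarith)
        _ = 2 ^ q * g ^ q := Real.mul_rpow (by norm_num) hg
        _ ≤ _ := by gcongr; have := Real.rpow_nonneg hs q; linarith
    · calc (4 * m * x + g) ^ q ≤ (2 * (4 * m * x)) ^ q :=
            Real.rpow_le_rpow (by positivity) (by linarith) (by linarith)
        _ = 2 ^ q * (4 * m * x) ^ q := Real.mul_rpow (by norm_num) hs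
        _ ≤ _ := by gcongr; have := Real.rpow_nonneg hg q; linarith
  have h2 : (4 * m * x) ^ q = 4 ^ q * (m ^ q * x ^ q) := by
    rw [Real.mul_rpow (by positivity) hx, Real.mul_rpow (by norm_num) hm]; ring
  rw [h2] at h1
  have h4 : (1 : ℝ) ≤ 4 ^ q := Real.one_le_rpow (by norm_num) (by linarith)
  have hX := Real.rpow_nonneg hx q
  have hG := Real.rpow_nonneg hg q
  have hmq := Real.rpow_nonneg hm q
  set X := x ^ q
  set G := g ^ q
  set A := m ^ q
  have h3 : 4 ^ q * (A * X) + G ≤ 4 ^ q * (A * X + G) := by nlinarith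
  have h5 : 4 * n * x + g ≤ 4 * (n * x + g) := by linarith
  have h6 : (A * X + G) * (n * x + g) ≤ A * n * X + A * (X * g) + 2 * G := by
    have e : (A * X + G) * (n * x + g) = A * n * X * x + A * (X * g) + (n * x) * G + g * G := by ring
    have e1 : A * n * X * x ≤ A * n * X := mul_le_of_le_one_right (by positivity) hx1
    have e2 : (n * x) * G ≤ G := mul_le_of_le_one_left hG (by nlinarith)
    have e3 : g * G ≤ G := mul_le_of_le_one_left hG hg1
    linarith
  calc (4 * m * x + g) ^ q * (4 * n * x + g)
      ≤ (2 ^ q * (4 ^ q * (A * X + G))) * (4 * (n * x + g)) := by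
        apply mul_le_mul _ h5 (by positivity) (by positivity)
        refine h1.trans ?_
        gcongr
    _ = 2 ^ q * 4 ^ q * 4 * ((A * X + G) * (n * x + g)) := by ring
    _ ≤ _ := by gcongr

/-- the summand -/
def tau (q : ℝ) (u v : ℝ → ℝ) (I : ℝ × ℝ) : ℝ := avg u I ^ q * avg v I * len I

lemma tau_nonneg {q : ℝ} {u v : ℝ → ℝ} (hu : ∀ x, 0 ≤ u x) (hv : ∀ x, 0 ≤ v x) {I : ℝ × ℝ}
    (hlt : I.1 < I.2) : 0 ≤ tau q u v I := by
  have h1 := avg_nonneg hu hlt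
  have h2 := avg_nonneg hv hlt
  have h3 : 0 ≤ len I := by simp only [len]; linarith
  unfold tau; positivity

/-- intersection of intervals -/
def cap (I K : ℝ × ℝ) : ℝ × ℝ := (max I.1 K.1, min I.2 K.2)

lemma cap_set (I K : ℝ × ℝ) : ivSet (cap I K) = ivSet I ∩ ivSet K := by
  simp only [ivSet, cap, Ico_inter_Ico]

lemma b_pow {q b c : ℝ} (hb : 0 < b) (hbc : b ^ q * c = b) (n : ℕ) : (b ^ n) ^ q * c ^ n = b ^ n := by
  have : (b ^ n) ^ q = (b ^ q) ^ n := by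
    rw [← Real.rpow_natCast b n, ← Real.rpow_mul hb.le, mul_comm, Real.rpow_mul hb.le, Real.rpow_natCast]
  rw [this, ← mul_pow, hbc]

lemma tau_class {k : ℕ} (hk : 3000 < k) {ch : ℝ × ℝ → Bool} {u v : ℝ → ℝ} {b M c N q : ℝ} (hq : 1 < q)
    (hu : Good k ch u b M) (hv : Good k ch v c N) (hbc : b ^ q * c = b)
    {i : ℕ} {K : ℝ × ℝ} (hK : K ∈ Kfam k i) {I : ℝ × ℝ} (hlt : I.1 < I.2)
    (hIK : ivSet I ⊆ ivSet K) (hI : ∀ j < 3 ^ (k - 1), ¬ ivSet I ⊆ ivSet (chd k K j)) :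
    tau q u v I ≤ b ^ (i + 1) * (2 ^ q * 4 ^ q * 4) * ((M ^ q * N * rel I (ivSet (mid K)) ^ q +
      M ^ q * (rel I (ivSet (mid K)) ^ q * rel I (ivSet (GK k ch K))) +
      2 * rel I (ivSet (GK k ch K)) ^ q) * len I) := by
  have hl : 0 < len I := by simp only [len]; linarith
  have h1 := avg_class hk hu hK hlt hIK hI
  have h2 := avg_class hk hv hK hlt hIK hI
  have n1 := avg_nonneg hu.nonneg hlt
  have n2 := avg_nonneg hv.nonneg hlt
  have x0 := rel_nonneg hlt (ivSet (mid K))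
  have x1 := rel_le_one hlt (ivSet (mid K))
  have g0 := rel_nonneg hlt (ivSet (GK k ch K))
  have g1 := rel_le_one hlt (ivSet (GK k ch K))
  have hb := hu.bpos
  have hc := hv.bpos
  have hM := hu.M0
  have hN := hv.M0
  have hpt := pt_ineq hq x0 x1 g0 g1 hu.M0 hv.M0 hv.M1
  set x := rel I (ivSet (mid K))
  set g := rel I (ivSet (GK k ch K))
  unfold tau
  calc avg u I ^ q * avg v I * len I
      ≤ (b ^ (i + 1) * (4 * M * x + g)) ^ q * (c ^ (i + 1) * (4 * N * x + g)) * len I := by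
        gcongr
    _ = ((b ^ (i + 1)) ^ q * c ^ (i + 1)) * ((4 * M * x + g) ^ q * (4 * N * x + g)) * len I := by
        rw [Real.mul_rpow (by positivity) (by positivity)]; ring
    _ = b ^ (i + 1) * ((4 * M * x + g) ^ q * (4 * N * x + g)) * len I := by rw [b_pow hb hbc]
    _ ≤ b ^ (i + 1) * (2 ^ q * 4 ^ q * 4 * (M ^ q * N * x ^ q + M ^ q * (x ^ q * g) + 2 * g ^ q)) * len I := by
        gcongr
    _ = _ := by ring

/-- constant of the local lemma -/
def RC (q : ℝ) : ℝ := 2 ^ q * 4 ^ q * 4 * (2 * Cs q + 18)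

lemma RC_pos (q : ℝ) : 0 < RC q := by
  have := Cs_nonneg q
  unfold RC; positivity

lemma rel_sub {I L A : ℝ × ℝ} (h : ivSet I ⊆ ivSet L) : rel I (ivSet A) = rel I (ivSet (cap A L)) := by
  unfold rel
  rw [cap_set]
  congr 2
  ext x; simp only [mem_inter_iff]
  constructor
  · rintro ⟨h1, h2⟩; exact ⟨h1, h2, h h1⟩
  · rintro ⟨h1, h2, _⟩; exact ⟨h1, h2⟩

lemma local_R {k : ℕ} (hk : 3000 < k) {ch : ℝ × ℝ → Bool} {u v : ℝ → ℝ} {b M c N q : ℝ} (hq : 1 < q)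
    (hu : Good k ch u b M) (hv : Good k ch v c N) (hbc : b ^ q * c = b)
    {i : ℕ} {K L : ℝ × ℝ} (hK : K ∈ Kfam k i) (hLK : ivSet L ⊆ ivSet K)
    {θ : ℝ} (hθ : 0 < θ) {F : Finset (ℝ × ℝ)} {Es : ℝ × ℝ → Set ℝ} (hF : CF θ F Es)
    (hFL : ∀ I ∈ F, ivSet I ⊆ ivSet L)
    (hI : ∀ I ∈ F, ∀ j < 3 ^ (k - 1), ¬ ivSet I ⊆ ivSet (chd k K j)) :
    θ * ∑ I ∈ F, tau q u v I ≤ RC q * b ^ (i + 1) * (M ^ q * N * volume.real (ivSet (mid K) ∩ ivSet L) +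
      volume.real (ivSet (GK k ch K) ∩ ivSet L) + M ^ q * (k * (len K / 3 ^ k))) := by
  have hl := len_Kfam_pos hK
  have hb := hu.bpos
  have hM := hu.M0
  have hN := hv.M0
  have hCs := Cs_nonneg q
  have s1 := sum_pow hF hq (cap (mid K) L)
  have s2 := sum_pow hF hq (cap (GK k ch K) L)
  have s3 := sum_cross hk hF hl (len_GK k ch K) (GK_sub hk ch hl) (fun I hI => (hFL I hI).trans hLK)
  rw [cap_set] at s1 s2
  rw [len_GK] at s3
  have hD := (D_small hk hl).1
  set D := len K / 3 ^ k
  set VJ := volume.real (ivSet (mid K) ∩ ivSet L)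
  set VG := volume.real (ivSet (GK k ch K) ∩ ivSet L)
  have hVJ : 0 ≤ VJ := measureReal_nonneg
  have hVG : 0 ≤ VG := measureReal_nonneg
  have hMq : 0 ≤ M ^ q := Real.rpow_nonneg hM q
  calc θ * ∑ I ∈ F, tau q u v I
      ≤ θ * ∑ I ∈ F, b ^ (i + 1) * (2 ^ q * 4 ^ q * 4) *
        (M ^ q * N * (rel I (ivSet (mid K) ∩ ivSet L) ^ q * len I) +
        M ^ q * (rel I (ivSet (GK k ch K)) * len I) +
        2 * (rel I (ivSet (GK k ch K) ∩ ivSet L) ^ q * len I)) := by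
        gcongr with I hIF
        have hlt := (hF.1 I hIF).1
        have hlI : 0 < len I := by simp only [len]; linarith
        refine (tau_class hk hq hu hv hbc hK hlt ((hFL I hIF).trans hLK) (hI I hIF)).trans ?_
        have e1 := rel_sub (A := mid K) (hFL I hIF)
        have e2 := rel_sub (A := GK k ch K) (hFL I hIF)
        rw [cap_set] at e1 e2
        rw [← e1, ← e2]
        have x0 := rel_nonneg hlt (ivSet (mid K))
        have x1 := rel_le_one hlt (ivSet (mid K))
        have g0 := rel_nonneg hlt (ivSet (GK k ch K))
        set x := rel I (ivSet (mid K))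
        set g := rel I (ivSet (GK k ch K))
        have hx : x ^ q ≤ 1 := Real.rpow_le_one x0 x1 (by linarith)
        have hxg : x ^ q * g ≤ g := mul_le_of_le_one_left g0 hx
        apply mul_le_mul_of_nonneg_left _ (by positivity)
        have := mul_le_mul_of_nonneg_right (mul_le_mul_of_nonneg_left hxg hMq) hlI.le
        nlinarith
    _ = b ^ (i + 1) * (2 ^ q * 4 ^ q * 4) *
        (M ^ q * N * (θ * ∑ I ∈ F, rel I (ivSet (mid K) ∩ ivSet L) ^ q * len I) +
        M ^ q * (θ * ∑ I ∈ F, rel I (ivSet (GK k ch K)) * len I) +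
        2 * (θ * ∑ I ∈ F, rel I (ivSet (GK k ch K) ∩ ivSet L) ^ q * len I)) := by
        rw [← Finset.mul_sum, Finset.sum_add_distrib, Finset.sum_add_distrib, ← Finset.mul_sum,
          ← Finset.mul_sum, ← Finset.mul_sum]
        ring
    _ ≤ b ^ (i + 1) * (2 ^ q * 4 ^ q * 4) *
        (M ^ q * N * (Cs q * VJ) + M ^ q * (18 * k * D) + 2 * (Cs q * VG)) := by
        gcongr
    _ ≤ b ^ (i + 1) * (2 ^ q * 4 ^ q * 4) * ((2 * Cs q + 18) * (M ^ q * N * VJ + VG + M ^ q * (k * D))) := by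
        gcongr
        have a1 : 0 ≤ M ^ q * N * VJ := by positivity
        have a2 : 0 ≤ M ^ q * (k * D) := by positivity
        nlinarith [mul_nonneg hCs a1, mul_nonneg hCs a2]
    _ = _ := by unfold RC; ring

lemma local_R2 {k : ℕ} (hk : 3000 < k) {ch : ℝ × ℝ → Bool} {u v : ℝ → ℝ} {b M c N q : ℝ} (hq : 1 < q)
    (hu : Good k ch u b M) (hv : Good k ch v c N) (hbc : b ^ q * c = b)
    {i : ℕ} {K L : ℝ × ℝ} (hK : K ∈ Kfam k i) (hLK : ivSet L ⊆ ivSet K)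
    {θ : ℝ} (hθ : 0 < θ) {F : Finset (ℝ × ℝ)} {Es : ℝ × ℝ → Set ℝ} (hF : CF θ F Es)
    (hFL : ∀ I ∈ F, ivSet I ⊆ ivSet L)
    (hI : ∀ I ∈ F, ∀ j < 3 ^ (k - 1), ¬ ivSet I ⊆ ivSet (chd k K j))
    (hE : ivSet (mid K) ∩ ivSet L = ∅) :
    θ * ∑ I ∈ F, tau q u v I ≤ RC q * b ^ (i + 1) * volume.real (ivSet (GK k ch K) ∩ ivSet L) := by
  have hl := len_Kfam_pos hK
  have hb := hu.bpos
  have hCs := Cs_nonneg q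
  have s2 := sum_pow hF hq (cap (GK k ch K) L)
  rw [cap_set] at s2
  set VG := volume.real (ivSet (GK k ch K) ∩ ivSet L)
  have hVG : 0 ≤ VG := measureReal_nonneg
  calc θ * ∑ I ∈ F, tau q u v I
      ≤ θ * ∑ I ∈ F, b ^ (i + 1) * (2 ^ q * 4 ^ q * 4) *
        (2 * (rel I (ivSet (GK k ch K) ∩ ivSet L) ^ q * len I)) := by
        gcongr with I hIF
        have hlt := (hF.1 I hIF).1
        refine (tau_class hk hq hu hv hbc hK hlt ((hFL I hIF).trans hLK) (hI I hIF)).trans ?_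
        have e1 := rel_sub (A := mid K) (hFL I hIF)
        have e2 := rel_sub (A := GK k ch K) (hFL I hIF)
        rw [cap_set] at e1 e2
        have e3 : rel I (ivSet (mid K)) = 0 := by rw [e1, hE]; simp [rel]
        rw [← e2, e3, Real.zero_rpow (by linarith)]
        apply le_of_eq; ring
    _ = b ^ (i + 1) * (2 ^ q * 4 ^ q * 4) *
        (2 * (θ * ∑ I ∈ F, rel I (ivSet (GK k ch K) ∩ ivSet L) ^ q * len I)) := by
        rw [← Finset.mul_sum, ← Finset.mul_sum]
        ring
    _ ≤ b ^ (i + 1) * (2 ^ q * 4 ^ q * 4) * (2 * (Cs q * VG)) := by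
        gcongr
    _ ≤ b ^ (i + 1) * (2 ^ q * 4 ^ q * 4) * ((2 * Cs q + 18) * VG) := by
        exact mul_le_mul_of_nonneg_left (by nlinarith) (by positivity)
    _ = _ := by unfold RC; ring

/-- constant for the thin case -/
def YC (q : ℝ) : ℝ := 4 ^ (q + 1) * Cs (q + 1)

lemma local_Y {k : ℕ} (hk : 3000 < k) {ch : ℝ × ℝ → Bool} {u v : ℝ → ℝ} {b M c N q : ℝ} (hq : 1 < q)
    (hu : Good k ch u b M) (hv : Good k ch v c N)
    {i : ℕ} {K L : ℝ × ℝ} (hK : K ∈ Kfam k i) (hLK : ivSet L ⊆ ivSet K)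
    {θ : ℝ} (hθ : 0 < θ) {F : Finset (ℝ × ℝ)} {Es : ℝ × ℝ → Set ℝ} (hF : CF θ F Es)
    (hFL : ∀ I ∈ F, ivSet I ⊆ ivSet L)
    (hI : ∀ I ∈ F, ∀ j < 3 ^ (k - 1), ¬ ivSet I ⊆ ivSet (chd k K j))
    {j : ℕ} (hj : j < 3 ^ (k - 1))
    (hJ : ivSet (mid K) ∩ ivSet L ⊆ ivSet (chd k K j))
    (hG : ivSet (GK k ch K) ∩ ivSet L = ∅) :
    θ * ∑ I ∈ F, tau q u v I ≤ YC q * ((∫ x in ivSet L, u x) ^ q * (∫ x in ivSet L, v x) /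
      (len K / 3 ^ k) ^ q) := by
  have hl := len_Kfam_pos hK
  have hD := (D_small hk hl).1
  have s1 := sum_pow hF (s := q + 1) (by linarith) (chd k K j)
  have hlc := len_chd k K j
  rw [vol_ivSet (by simp only [len] at hlc hD; linarith), hlc] at s1
  set D := len K / 3 ^ k
  have Upos := int_nn hu.nonneg (ivSet L)
  have Vpos := int_nn hv.nonneg (ivSet L)
  set A := ∫ x in ivSet L, u x
  set B := ∫ x in ivSet L, v x
  have hzero : ∀ I ∈ F, volume.real (ivSet I ∩ ivSet (chd k K j)) < D / 4 → ∫ x in ivSet I, u x = 0 := by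
    intro I hIF hs
    rw [split_int hk hu hK (ivSet_meas I) ((hFL I hIF).trans hLK)]
    have hg : ivSet I ∩ ivSet (GK k ch K) = ∅ := by
      rw [← subset_empty_iff, ← hG]
      rintro x ⟨h1, h2⟩; exact ⟨h2, hFL I hIF h1⟩
    rw [hg, measureReal_empty, mul_zero, add_zero]
    apply Finset.sum_eq_zero
    intro j' hj'
    by_cases hjj : j' = j
    · subst hjj
      exact u_zero_small hk hu (chd_mem hK hj) (hI I hIF _ hj) (by rw [hlc]; exact hs)
    · have : ivSet I ∩ ivSet (chd k K j') = ∅ := by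
        rw [← subset_empty_iff]
        rintro x ⟨h1, h2⟩
        have h3 := hJ ⟨chd_sub hk hl (Finset.mem_range.1 hj') h2, hFL I hIF h1⟩
        exact Set.disjoint_left.1 (chd_disj hk hl hjj) h2 h3
      rw [this]; simp
  calc θ * ∑ I ∈ F, tau q u v I
      ≤ θ * ∑ I ∈ F, (A ^ q * B * (4 / D) ^ (q + 1)) * (rel I (ivSet (chd k K j)) ^ (q + 1) * len I) := by
        gcongr with I hIF
        have hlt := (hF.1 I hIF).1
        have hlI : 0 < len I := by simp only [len]; linarith
        have x0 := rel_nonneg hlt (ivSet (chd k K j))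
        by_cases hs : volume.real (ivSet I ∩ ivSet (chd k K j)) < D / 4
        · have : tau q u v I = 0 := by
            unfold tau avg mass
            rw [hzero I hIF hs, zero_div, Real.zero_rpow (by linarith)]; ring
          rw [this]; positivity
        · push Not at hs
          have h1 : 1 / len I ≤ 4 / D * rel I (ivSet (chd k K j)) := by
            unfold rel
            rw [div_mul_div_comm, div_le_div_iff₀ hlI (by positivity)]
            nlinarith
          have hA : avg u I ≤ A * (1 / len I) := by
            unfold avg mass
            rw [mul_one_div]
            gcongr
            exact int_mono hu.nonneg hu.int (hFL I hIF)
          have hB : avg v I ≤ B * (1 / len I) := by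
            unfold avg mass
            rw [mul_one_div]
            gcongr
            exact int_mono hv.nonneg hv.int (hFL I hIF)
          have n1 := avg_nonneg hu.nonneg hlt
          have n2 := avg_nonneg hv.nonneg hlt
          set y := 4 / D * rel I (ivSet (chd k K j)) with hy
          have hy0 : 0 < y := lt_of_lt_of_le (by positivity) h1
          unfold tau
          calc avg u I ^ q * avg v I * len I ≤ (A * y) ^ q * (B * y) * len I := by
                gcongr
                · exact hA.trans (by gcongr)
                · exact hB.trans (by gcongr)
            _ = A ^ q * B * y ^ (q + 1) * len I := by
                rw [Real.mul_rpow Upos hy0.le, Real.rpow_add_one hy0.ne']; ring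
            _ = _ := by
                rw [hy, Real.mul_rpow (by positivity) x0]; ring
    _ = (A ^ q * B * (4 / D) ^ (q + 1)) * (θ * ∑ I ∈ F, rel I (ivSet (chd k K j)) ^ (q + 1) * len I) := by
        rw [← Finset.mul_sum]; ring
    _ ≤ (A ^ q * B * (4 / D) ^ (q + 1)) * (Cs (q + 1) * D) := by
        gcongr
    _ = _ := by
        unfold YC
        rw [Real.div_rpow (by norm_num) hD.le, Real.rpow_add_one hD.ne']
        have : D ^ q ≠ 0 := (Real.rpow_pos_of_pos hD q).ne'
        field_simp

/-! ### Induction over generations -/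

open Classical in
/-- testing sum of the members contained in `A` -/
def TT (q : ℝ) (u v : ℝ → ℝ) (F : Finset (ℝ × ℝ)) (A : Set ℝ) : ℝ :=
  ∑ I ∈ F.filter (fun I => ivSet I ⊆ A), tau q u v I

lemma TT_empty {θ q : ℝ} {u v : ℝ → ℝ} {F : Finset (ℝ × ℝ)} {Es : ℝ × ℝ → Set ℝ} (hF : CF θ F Es) :
    TT q u v F ∅ = 0 := by
  classical
  unfold TT
  rw [Finset.filter_false_of_mem, Finset.sum_empty]
  intro I hI h
  exact h (show I.1 ∈ ivSet I from ⟨le_rfl, (hF.1 I hI).1⟩)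

lemma TT_base {θ q : ℝ} {u v : ℝ → ℝ} {F : Finset (ℝ × ℝ)} {Es : ℝ × ℝ → Set ℝ} (hF : CF θ F Es)
    {k i : ℕ} {K : ℝ × ℝ} (hK : K ∈ Kfam k i) (hlen : ∀ I ∈ F, 1 / (3 ^ k) ^ i < len I)
    {A : Set ℝ} (hA : A ⊆ ivSet K) : TT q u v F A = 0 := by
  classical
  unfold TT
  rw [Finset.filter_false_of_mem, Finset.sum_empty]
  intro I hI h
  have h1 := hlen I hI
  rw [← len_Kfam k i K hK] at h1
  have hl := len_Kfam_pos hK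
  have h2 := measureReal_mono (μ := volume) (h.trans hA) (ivSet_fin K)
  rw [vol_ivSet (hF.1 I hI).1.le, vol_ivSet (by simp only [len] at hl; linarith)] at h2
  linarith

open Classical in
/-- members of `F` in `L`, in no child of `K` -/
def cls (k : ℕ) (K : ℝ × ℝ) (F : Finset (ℝ × ℝ)) (L : ℝ × ℝ) : Finset (ℝ × ℝ) :=
  F.filter (fun I => ivSet I ⊆ ivSet L ∧ ∀ j < 3 ^ (k - 1), ¬ ivSet I ⊆ ivSet (chd k K j))

lemma decomp {θ q : ℝ} {k : ℕ} {u v : ℝ → ℝ} {F : Finset (ℝ × ℝ)} {Es : ℝ × ℝ → Set ℝ} (hF : CF θ F Es)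
    (hu : ∀ x, 0 ≤ u x) (hv : ∀ x, 0 ≤ v x) (K L : ℝ × ℝ) :
    TT q u v F (ivSet L) ≤ ∑ I ∈ cls k K F L, tau q u v I +
      ∑ j ∈ Finset.range (3 ^ (k - 1)), TT q u v F (ivSet L ∩ ivSet (chd k K j)) := by
  classical
  have h0 : ∀ I ∈ F, 0 ≤ tau q u v I := fun I hI => tau_nonneg hu hv (hF.1 I hI).1
  unfold TT cls
  simp only [Finset.sum_filter]
  rw [Finset.sum_comm, ← Finset.sum_add_distrib]
  apply Finset.sum_le_sum
  intro I hI
  have hn := h0 I hI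
  have hs : 0 ≤ ∑ j ∈ Finset.range (3 ^ (k - 1)),
      (if ivSet I ⊆ ivSet L ∩ ivSet (chd k K j) then tau q u v I else 0) :=
    Finset.sum_nonneg (fun j _ => by split_ifs <;> simp [hn])
  by_cases hL : ivSet I ⊆ ivSet L
  · by_cases hc : ∀ j < 3 ^ (k - 1), ¬ ivSet I ⊆ ivSet (chd k K j)
    · rw [if_pos hL, if_pos ⟨hL, hc⟩]; linarith
    · rw [if_pos hL, if_neg (fun h => hc h.2), zero_add]
      push Not at hc
      obtain ⟨j, hj, hIj⟩ := hc
      have := Finset.single_le_sum (f := fun j =>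
        (if ivSet I ⊆ ivSet L ∩ ivSet (chd k K j) then tau q u v I else 0))
        (fun j _ => by
          show 0 ≤ (if ivSet I ⊆ ivSet L ∩ ivSet (chd k K j) then tau q u v I else 0)
          split_ifs <;> simp [hn])
        (Finset.mem_range.2 hj)
      simp only [if_pos (subset_inter hL hIj)] at this
      exact this
  · rw [if_neg hL]
    have : 0 ≤ (if ivSet I ⊆ ivSet L ∧ ∀ j < 3 ^ (k - 1), ¬ ivSet I ⊆ ivSet (chd k K j)
        then tau q u v I else 0) := by split_ifs <;> simp [hn]
    linarith

lemma cls_sub (k : ℕ) (K : ℝ × ℝ) (F : Finset (ℝ × ℝ)) (L : ℝ × ℝ) : cls k K F L ⊆ F := by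
  classical
  exact Finset.filter_subset _ _

lemma cls_L {k : ℕ} {K : ℝ × ℝ} {F : Finset (ℝ × ℝ)} {L : ℝ × ℝ} : ∀ I ∈ cls k K F L, ivSet I ⊆ ivSet L := by
  classical
  intro I hI
  exact (Finset.mem_filter.1 hI).2.1

lemma cls_c {k : ℕ} {K : ℝ × ℝ} {F : Finset (ℝ × ℝ)} {L : ℝ × ℝ} : ∀ I ∈ cls k K F L,
    ∀ j < 3 ^ (k - 1), ¬ ivSet I ⊆ ivSet (chd k K j) := by
  classical
  intro I hI
  exact (Finset.mem_filter.1 hI).2.2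

lemma full_bound {k : ℕ} (hk : 3000 < k) {ch : ℝ × ℝ → Bool} {u v : ℝ → ℝ} {b M c N q : ℝ} (hq : 1 < q)
    (hu : Good k ch u b M) (hv : Good k ch v c N) (hbc : b ^ q * c = b) (hMN : M ^ q * N ≤ 2 / 3 ^ k)
    {θ : ℝ} (hθ : 0 < θ) {F : Finset (ℝ × ℝ)} {Es : ℝ × ℝ → Set ℝ} (hF : CF θ F Es) (n : ℕ) :
    ∀ i, ∀ K ∈ Kfam k i, (∀ I ∈ F, 1 / (3 ^ k) ^ (i + n) < len I) →
    θ * TT q u v F (ivSet K) ≤ 2 * RC q * k * ∫ x in ivSet K, u x := by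
  have hRC := RC_pos q
  have hkR : (3 : ℝ) ≤ k := by exact_mod_cast (by omega : 3 ≤ k)
  induction n with
  | zero =>
    intro i K hK hlen
    rw [TT_base hF hK hlen subset_rfl, mul_zero]
    have := int_nn hu.nonneg (ivSet K)
    positivity
  | succ n ih =>
    intro i K hK hlen
    have hl := len_Kfam_pos hK
    have hlt : K.1 ≤ K.2 := by simp only [len] at hl; linarith
    have hD := (D_small hk hl).1
    have hR := local_R hk hq hu hv hbc hK (subset_refl (ivSet K)) hθ (hF.mono (cls_sub k K F K)) cls_L cls_c
    have hsp := split_int hk hu hK (ivSet_meas K) subset_rfl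
    have hb := pow_pos hu.bpos (i + 1)
    have hGs := GK_sub hk ch hl
    have e1 : ivSet K ∩ ivSet (GK k ch K) = ivSet (GK k ch K) := inter_eq_right.2 hGs
    have e2 : ivSet (GK k ch K) ∩ ivSet K = ivSet (GK k ch K) := inter_eq_left.2 hGs
    have e3 : volume.real (ivSet (GK k ch K)) = len K / 3 ^ k := by
      have := len_GK k ch K
      rw [vol_ivSet (by simp only [len] at this hD; linarith), this]
    rw [e1, e3] at hsp
    rw [e2, e3] at hR
    have hmid : volume.real (ivSet (mid K) ∩ ivSet K) ≤ len K := by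
      rw [← vol_ivSet hlt]; exact measureReal_mono inter_subset_right (ivSet_fin K)
    have hMq0 : 0 ≤ M ^ q := Real.rpow_nonneg hu.M0 q
    have hMq : M ^ q ≤ 1 := Real.rpow_le_one hu.M0 hu.M1 (by linarith)
    have hin : M ^ q * N * volume.real (ivSet (mid K) ∩ ivSet K) + len K / 3 ^ k +
        M ^ q * (k * (len K / 3 ^ k)) ≤ 2 * k * (len K / 3 ^ k) := by
      have a1 : M ^ q * N * volume.real (ivSet (mid K) ∩ ivSet K) ≤ 2 * (len K / 3 ^ k) := by
        calc M ^ q * N * volume.real (ivSet (mid K) ∩ ivSet K) ≤ 2 / 3 ^ k * len K :=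
              mul_le_mul hMN hmid measureReal_nonneg (by positivity)
          _ = _ := by ring
      have a2 : M ^ q * (k * (len K / 3 ^ k)) ≤ k * (len K / 3 ^ k) :=
        mul_le_of_le_one_left (by positivity) hMq
      nlinarith
    have hR' := hR.trans (mul_le_mul_of_nonneg_left hin (by positivity))
    have hdec := mul_le_mul_of_nonneg_left (decomp (q := q) (k := k) hF hu.nonneg hv.nonneg K K) hθ.le
    have hch : θ * ∑ j ∈ Finset.range (3 ^ (k - 1)), TT q u v F (ivSet K ∩ ivSet (chd k K j)) ≤
        2 * RC q * k * ∑ j ∈ Finset.range (3 ^ (k - 1)), ∫ x in ivSet K ∩ ivSet (chd k K j), u x := by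
      rw [Finset.mul_sum, Finset.mul_sum]
      apply Finset.sum_le_sum
      intro j hj
      have hj' := Finset.mem_range.1 hj
      rw [inter_eq_right.2 ((chd_sub hk hl hj').trans (mid_sub hl))]
      apply ih (i + 1) _ (chd_mem hK hj')
      intro I hI
      have := hlen I hI
      rwa [show i + 1 + n = i + (n + 1) by ring]
    rw [hsp]
    nlinarith

lemma Y_le {k : ℕ} {ch : ℝ × ℝ → Bool} {u v : ℝ → ℝ} {b M c N q : ℝ} (hq : 1 < q)
    (hu : Good k ch u b M) (hv : Good k ch v c N) (hbc : b ^ q * c = b)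
    {i : ℕ} {K L : ℝ × ℝ} (hK : K ∈ Kfam k i) (hLK : ivSet L ⊆ ivSet K) :
    (∫ x in ivSet L, u x) ^ q * (∫ x in ivSet L, v x) / (len K) ^ q ≤ ∫ x in ivSet L, u x := by
  have hl := len_Kfam_pos hK
  have hb := pow_pos hu.bpos i
  have hc := pow_pos hv.bpos i
  have hU0 := int_nn hu.nonneg (ivSet L)
  have hV0 := int_nn hv.nonneg (ivSet L)
  have hU : ∫ x in ivSet L, u x ≤ b ^ i * len K := by
    refine (int_mono hu.nonneg hu.int hLK).trans ?_
    rw [hu.mass i K hK, mul_assoc]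
    exact mul_le_of_le_one_left (by positivity) hu.M1
  have hV : ∫ x in ivSet L, v x ≤ c ^ i * len K := by
    refine (int_mono hv.nonneg hv.int hLK).trans ?_
    rw [hv.mass i K hK, mul_assoc]
    exact mul_le_of_le_one_left (by positivity) hv.M1
  set A := ∫ x in ivSet L, u x
  set B := ∫ x in ivSet L, v x
  have hp : 0 < b ^ i * len K := by positivity
  obtain ⟨t, ht⟩ : ∃ t, t = A / (b ^ i * len K) := ⟨_, rfl⟩
  have hA : A = t * (b ^ i * len K) := by rw [ht]; field_simp
  have ht0 : 0 ≤ t := by rw [ht]; positivity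
  have ht1 : t ≤ 1 := by rw [ht]; exact (div_le_one hp).2 hU
  have htq : t ^ q ≤ t := by
    have := Real.rpow_le_rpow_of_exponent_ge' ht0 ht1 zero_le_one hq.le
    simpa using this
  have hlq : 0 < len K ^ q := Real.rpow_pos_of_pos hl q
  rw [div_le_iff₀ hlq]
  calc A ^ q * B ≤ A ^ q * (c ^ i * len K) := by gcongr
    _ = t ^ q * ((b ^ i) ^ q * c ^ i) * len K * len K ^ q := by
        rw [hA, Real.mul_rpow ht0 hp.le, Real.mul_rpow hb.le hl.le]; ring
    _ = t ^ q * (b ^ i * len K) * len K ^ q := by rw [b_pow hu.bpos hbc]; ring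
    _ ≤ t * (b ^ i * len K) * len K ^ q := by gcongr
    _ = _ := by rw [hA]

/-! ### Partial intervals -/

lemma struct {k : ℕ} (hk : 3000 < k) {K L : ℝ × ℝ} (hl : 0 < len K)
    (hend : L.1 = K.1 ∨ L.2 = K.2) :
    ∃ j0 : ℕ, ∀ j < 3 ^ (k - 1), j ≠ j0 →
      (ivSet (chd k K j) ⊆ ivSet L ∨ ivSet L ∩ ivSet (chd k K j) = ∅) := by
  have hD := (D_small hk hl).1
  have hmidK : ∀ j < 3 ^ (k - 1), K.1 ≤ (chd k K j).1 ∧ (chd k K j).2 ≤ K.2 ∧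
      (chd k K j).1 < (chd k K j).2 := by
    intro j hj
    have hlc := len_chd k K j
    have hlt : (chd k K j).1 < (chd k K j).2 := by simp only [len] at hlc hD; linarith
    have hs := (chd_sub hk hl hj).trans (mid_sub hl)
    have := (Ico_subset_Ico_iff hlt).1 hs
    exact ⟨this.1, this.2, hlt⟩
  have key : ∀ x : ℝ, (∀ j < 3 ^ (k - 1), x ∉ ivSet (chd k K j) →
      (ivSet (chd k K j) ⊆ ivSet L ∨ ivSet L ∩ ivSet (chd k K j) = ∅)) →
      ∃ j0 : ℕ, ∀ j < 3 ^ (k - 1), j ≠ j0 →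
      (ivSet (chd k K j) ⊆ ivSet L ∨ ivSet L ∩ ivSet (chd k K j) = ∅) := by
    intro x hx
    by_cases h : ∃ j0, x ∈ ivSet (chd k K j0)
    · obtain ⟨j0, hj0⟩ := h
      exact ⟨j0, fun j hj hne => hx j hj (fun h' => Set.disjoint_left.1 (chd_disj hk hl hne) h' hj0)⟩
    · push Not at h
      exact ⟨0, fun j hj _ => hx j hj (h j)⟩
  rcases hend with he | he
  · apply key L.2
    intro j hj hx
    obtain ⟨h1, h2, h3⟩ := hmidK j hj
    by_cases h : (chd k K j).2 ≤ L.2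
    · left; exact Ico_subset_Ico (by linarith) h
    · right
      push Not at h
      rw [← subset_empty_iff]
      rintro y ⟨hy1, hy2⟩
      simp only [ivSet, mem_Ico] at hy1 hy2 hx
      exact hx ⟨by linarith, h⟩
  · apply key L.1
    intro j hj hx
    obtain ⟨h1, h2, h3⟩ := hmidK j hj
    by_cases h : L.1 ≤ (chd k K j).1
    · left; exact Ico_subset_Ico h (by linarith)
    · right
      push Not at h
      rw [← subset_empty_iff]
      rintro y ⟨hy1, hy2⟩
      simp only [ivSet, mem_Ico] at hy1 hy2 hx
      exact hx ⟨by linarith, by linarith⟩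

lemma cap_end {k : ℕ} (hk : 3000 < k) {K L : ℝ × ℝ} (hl : 0 < len K)
    (hend : L.1 = K.1 ∨ L.2 = K.2) {j : ℕ} (hj : j < 3 ^ (k - 1)) :
    (cap L (chd k K j)).1 = (chd k K j).1 ∨ (cap L (chd k K j)).2 = (chd k K j).2 := by
  have hD := (D_small hk hl).1
  have hlc := len_chd k K j
  have hlt : (chd k K j).1 < (chd k K j).2 := by simp only [len] at hlc hD; linarith
  have hs := (Ico_subset_Ico_iff hlt).1 ((chd_sub hk hl hj).trans (mid_sub hl))
  rcases hend with he | he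
  · left; simp only [cap]; exact max_eq_right (by rw [he]; exact hs.1)
  · right; simp only [cap]; exact min_eq_right (by rw [he]; exact hs.2)

lemma GK_geo {k : ℕ} (hk : 3000 < k) (ch : ℝ × ℝ → Bool) {K L : ℝ × ℝ} (hl : 0 < len K)
    (hend : L.1 = K.1 ∨ L.2 = K.2) (hnf : ∀ j < 3 ^ (k - 1), ¬ ivSet (chd k K j) ⊆ ivSet L)
    (hm : (ivSet (mid K) ∩ ivSet L).Nonempty) (hG : (ivSet (GK k ch K) ∩ ivSet L).Nonempty) :
    ivSet (GK k ch K) ⊆ ivSet L := by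
  have hD := D_small hk hl
  have hN := ND hk K
  obtain ⟨y, hy1, hy2⟩ := hm
  obtain ⟨z, hz1, hz2⟩ := hG
  have h2 := snd_eq K
  simp only [ivSet, mem_Ico, mid_fst, mid_snd] at hy1 hy2 hz1 hz2
  rcases hend with he | he
  · have hx : L.2 < K.1 + len K / 3 + len K / 3 ^ k := by
      by_contra hc
      push Not at hc
      apply hnf 0 (by positivity)
      apply Ico_subset_Ico <;> simp only [chd] <;> push_cast <;> linarith
    apply Ico_subset_Ico <;> rcases GK_cases k ch K with h' | h' <;> rw [h'.1, h'.2] at hz1 <;>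
      first | rw [h'.1] | rw [h'.2]
    all_goals linarith
  · have hx : K.1 + 2 * (len K / 3) - len K / 3 ^ k < L.1 := by
      by_contra hc
      push Not at hc
      have hpos : 0 < 3 ^ (k - 1) := by positivity
      apply hnf (3 ^ (k - 1) - 1) (by omega)
      have hcast : ((3 ^ (k - 1) - 1 : ℕ) : ℝ) = 3 ^ (k - 1) - 1 := by
        rw [Nat.cast_sub (by omega)]; push_cast; ring
      apply Ico_subset_Ico <;> simp only [chd, hcast] <;> nlinarith
    apply Ico_subset_Ico <;> rcases GK_cases k ch K with h' | h' <;> rw [h'.1, h'.2] at hz1 <;>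
      first | rw [h'.1] | rw [h'.2]
    all_goals linarith

/-- constant of the partial theorem -/
def AC (q : ℝ) : ℝ := 10 * RC q + 4 * YC q

lemma YC_nonneg (q : ℝ) : 0 ≤ YC q := by
  have := Cs_nonneg (q + 1)
  unfold YC; positivity

lemma AC_pos (q : ℝ) : 0 < AC q := by
  have := RC_pos q
  have := YC_nonneg q
  unfold AC; positivity

lemma R_full {k : ℕ} (hk : 3000 < k) {ch : ℝ × ℝ → Bool} {u v : ℝ → ℝ} {b M c N q : ℝ} (hq : 1 < q)
    (hu : Good k ch u b M) (hv : Good k ch v c N) (hbc : b ^ q * c = b)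
    {i : ℕ} {K L : ℝ × ℝ} (hK : K ∈ Kfam k i) (hLK : ivSet L ⊆ ivSet K)
    {θ : ℝ} (hθ : 0 < θ) {F : Finset (ℝ × ℝ)} {Es : ℝ × ℝ → Set ℝ} (hF : CF θ F Es)
    {j0 : ℕ} (hj0 : ∀ j < 3 ^ (k - 1), j ≠ j0 →
      (ivSet (chd k K j) ⊆ ivSet L ∨ ivSet L ∩ ivSet (chd k K j) = ∅))
    {j1 : ℕ} (hj1 : j1 < 3 ^ (k - 1)) (hfull : ivSet (chd k K j1) ⊆ ivSet L) :
    θ * ∑ I ∈ cls k K F L, tau q u v I ≤ 3 * RC q * k * ∫ x in ivSet L, u x := by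
  have hl := len_Kfam_pos hK
  have hD := (D_small hk hl).1
  have hRC := RC_pos q
  have hkR : (3 : ℝ) ≤ k := by exact_mod_cast (by omega : 3 ≤ k)
  have hR := local_R hk hq hu hv hbc hK hLK hθ (hF.mono (cls_sub k K F L)) cls_L cls_c
  rw [split_int hk hu hK (ivSet_meas L) hLK]
  rw [inter_comm (ivSet (mid K)), inter_comm (ivSet (GK k ch K)), vol_split hk hl (ivSet_meas L)] at hR
  have hb := pow_pos hu.bpos (i + 1)
  have hM := hu.M0
  have hchm : ∀ j < 3 ^ (k - 1), ∫ x in ivSet (chd k K j), u x = M * b ^ (i + 1) * (len K / 3 ^ k) := by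
    intro j hj; rw [hu.mass (i + 1) _ (chd_mem hK hj), len_chd]
  have hcv : ∀ j, volume.real (ivSet (chd k K j)) = len K / 3 ^ k := by
    intro j
    have := len_chd k K j
    rw [vol_ivSet (by simp only [len] at this hD; linarith), this]
  have hfn : ∀ j ∈ Finset.range (3 ^ (k - 1)), 0 ≤ ∫ x in ivSet L ∩ ivSet (chd k K j), u x :=
    fun j _ => int_nn hu.nonneg _
  have hf1 : ∫ x in ivSet L ∩ ivSet (chd k K j1), u x = M * b ^ (i + 1) * (len K / 3 ^ k) := by
    rw [inter_eq_right.2 hfull, hchm j1 hj1]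
  have hone := Finset.single_le_sum hfn (Finset.mem_range.2 hj1)
  rw [hf1] at hone
  set Sf := ∑ j ∈ Finset.range (3 ^ (k - 1)), ∫ x in ivSet L ∩ ivSet (chd k K j), u x
  have hvol : M * b ^ (i + 1) * ∑ j ∈ Finset.range (3 ^ (k - 1)), volume.real (ivSet L ∩ ivSet (chd k K j))
      ≤ 2 * Sf := by
    have : M * b ^ (i + 1) * ∑ j ∈ Finset.range (3 ^ (k - 1)), volume.real (ivSet L ∩ ivSet (chd k K j))
      ≤ ∑ j ∈ Finset.range (3 ^ (k - 1)), ((∫ x in ivSet L ∩ ivSet (chd k K j), u x) +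
        if j = j0 then M * b ^ (i + 1) * (len K / 3 ^ k) else 0) := by
      rw [Finset.mul_sum]
      apply Finset.sum_le_sum
      intro j hj
      have hj' := Finset.mem_range.1 hj
      by_cases hjj : j = j0
      · rw [if_pos hjj]
        have h1 : volume.real (ivSet L ∩ ivSet (chd k K j)) ≤ len K / 3 ^ k := by
          rw [← hcv j]; exact measureReal_mono inter_subset_right (ivSet_fin _)
        have h2 := mul_le_mul_of_nonneg_left h1 (by positivity : 0 ≤ M * b ^ (i + 1))
        linarith [hfn j hj]
      · rw [if_neg hjj, add_zero]
        rcases hj0 j hj' hjj with h | h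
        · rw [inter_eq_right.2 h, hchm j hj', hcv j]
        · rw [h]; simp
    refine this.trans ?_
    rw [Finset.sum_add_distrib, Finset.sum_ite_eq']
    have : (if j0 ∈ Finset.range (3 ^ (k - 1)) then M * b ^ (i + 1) * (len K / 3 ^ k) else 0) ≤ Sf := by
      split_ifs
      · exact hone
      · exact Finset.sum_nonneg hfn
    linarith
  have hMq0 : 0 ≤ M ^ q := Real.rpow_nonneg hu.M0 q
  have hMq : M ^ q ≤ M := by
    have := Real.rpow_le_rpow_of_exponent_ge' hM hu.M1 zero_le_one hq.le
    simpa using this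
  have hMqN : M ^ q * N ≤ M := (mul_le_of_le_one_right hMq0 hv.M1).trans hMq
  have hVs : 0 ≤ ∑ j ∈ Finset.range (3 ^ (k - 1)), volume.real (ivSet L ∩ ivSet (chd k K j)) :=
    Finset.sum_nonneg (fun _ _ => measureReal_nonneg)
  have hVG : 0 ≤ volume.real (ivSet L ∩ ivSet (GK k ch K)) := measureReal_nonneg
  set Vs := ∑ j ∈ Finset.range (3 ^ (k - 1)), volume.real (ivSet L ∩ ivSet (chd k K j))
  set VG := volume.real (ivSet L ∩ ivSet (GK k ch K))
  have hSf : 0 ≤ Sf := Finset.sum_nonneg hfn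
  have t1 : b ^ (i + 1) * (M ^ q * N * Vs) ≤ 2 * Sf := by
    refine le_trans ?_ hvol
    have := mul_le_mul_of_nonneg_right hMqN (mul_nonneg hb.le hVs)
    linarith
  have t2 : b ^ (i + 1) * (M ^ q * (k * (len K / 3 ^ k))) ≤ k * Sf := by
    have h1 := mul_le_mul_of_nonneg_right hMq (by positivity : 0 ≤ b ^ (i + 1) * (k * (len K / 3 ^ k)))
    have h2 := mul_le_mul_of_nonneg_left hone (by positivity : (0 : ℝ) ≤ k)
    linarith
  have t3 : 0 ≤ b ^ (i + 1) * VG := by positivity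
  calc θ * ∑ I ∈ cls k K F L, tau q u v I ≤ _ := hR
    _ = RC q * (b ^ (i + 1) * (M ^ q * N * Vs) + b ^ (i + 1) * VG +
        b ^ (i + 1) * (M ^ q * (k * (len K / 3 ^ k)))) := by ring
    _ ≤ RC q * (3 * k * (Sf + b ^ (i + 1) * VG)) := by
        apply mul_le_mul_of_nonneg_left _ hRC.le
        nlinarith
    _ = _ := by ring

lemma part_bound {k : ℕ} (hk : 3000 < k) {ch : ℝ × ℝ → Bool} {u v : ℝ → ℝ} {b M c N q : ℝ} (hq : 1 < q)
    (hu : Good k ch u b M) (hv : Good k ch v c N) (hbc : b ^ q * c = b) (hMN : M ^ q * N ≤ 2 / 3 ^ k)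
    {θ : ℝ} (hθ : 0 < θ) {F : Finset (ℝ × ℝ)} {Es : ℝ × ℝ → Set ℝ} (hF : CF θ F Es) (n : ℕ) :
    ∀ i, ∀ K ∈ Kfam k i, (∀ I ∈ F, 1 / (3 ^ k) ^ (i + n) < len I) →
    ∀ L : ℝ × ℝ, ivSet L ⊆ ivSet K → (L.1 = K.1 ∨ L.2 = K.2) →
    θ * TT q u v F (ivSet L) +
      2 * YC q * ((∫ x in ivSet L, u x) ^ q * (∫ x in ivSet L, v x) / (len K) ^ q) ≤
      AC q * k * ∫ x in ivSet L, u x := by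
  have hRC := RC_pos q
  have hYC := YC_nonneg q
  have hkR : (3 : ℝ) ≤ k := by exact_mod_cast (by omega : 3 ≤ k)
  induction n with
  | zero =>
    intro i K hK hlen L hLK hend
    rw [TT_base hF hK hlen hLK, mul_zero, zero_add]
    have h1 := int_nn hu.nonneg (ivSet L)
    have h2 := Y_le hq hu hv hbc hK hLK
    have h3 := mul_le_mul_of_nonneg_left h2 (by positivity : 0 ≤ 2 * YC q)
    refine h3.trans ?_
    apply mul_le_mul_of_nonneg_right _ h1
    unfold AC
    nlinarith
  | succ n ih =>
    intro i K hK hlen L hLK hend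
    have hl := len_Kfam_pos hK
    have hD := (D_small hk hl).1
    have hb := pow_pos hu.bpos (i + 1)
    have hM := hu.M0
    have hlen' : ∀ I ∈ F, 1 / (3 ^ k : ℝ) ^ (i + 1 + n) < len I := by
      intro I hI
      have := hlen I hI
      rwa [show i + 1 + n = i + (n + 1) by ring]
    have hdec := mul_le_mul_of_nonneg_left (decomp (q := q) (k := k) hF hu.nonneg hv.nonneg K L) hθ.le
    have hsu := split_int hk hu hK (ivSet_meas L) hLK
    have hY := Y_le hq hu hv hbc hK hLK
    have hU0 := int_nn hu.nonneg (ivSet L)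
    have hVG : 0 ≤ b ^ (i + 1) * volume.real (ivSet L ∩ ivSet (GK k ch K)) :=
      mul_nonneg hb.le measureReal_nonneg
    have hfn : ∀ j, 0 ≤ ∫ x in ivSet L ∩ ivSet (chd k K j), u x := fun j => int_nn hu.nonneg _
    have hone : ∀ j < 3 ^ (k - 1), (ivSet (chd k K j) ⊆ ivSet L ∨ ivSet L ∩ ivSet (chd k K j) = ∅) →
        θ * TT q u v F (ivSet L ∩ ivSet (chd k K j)) ≤
          2 * RC q * k * ∫ x in ivSet L ∩ ivSet (chd k K j), u x := by
      intro j hj h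
      rcases h with h | h
      · rw [inter_eq_right.2 h]
        exact full_bound hk hq hu hv hbc hMN hθ hF n (i + 1) _ (chd_mem hK hj) hlen'
      · rw [h, TT_empty hF]; simp
    obtain ⟨j0, hj0⟩ := struct hk hl hend
    by_cases hpart : ∃ j < 3 ^ (k - 1), ¬ (ivSet (chd k K j) ⊆ ivSet L ∨ ivSet L ∩ ivSet (chd k K j) = ∅)
    · obtain ⟨j, hj, hjp⟩ := hpart
      have hjj : j = j0 := by
        by_contra hne; exact hjp (hj0 j hj hne)
      subst hjj
      push Not at hjp
      obtain ⟨hjn, hje⟩ := hjp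
      have hjr : j ∈ Finset.range (3 ^ (k - 1)) := Finset.mem_range.2 hj
      -- inductive bound for the partial child
      have hih := ih (i + 1) _ (chd_mem hK hj) hlen' (cap L (chd k K j))
        (by rw [cap_set]; exact inter_subset_right) (cap_end hk hl hend hj)
      rw [cap_set, len_chd] at hih
      have hsum : θ * ∑ j' ∈ Finset.range (3 ^ (k - 1)), TT q u v F (ivSet L ∩ ivSet (chd k K j')) ≤
          θ * TT q u v F (ivSet L ∩ ivSet (chd k K j)) + 2 * RC q * k *
          ∑ j' ∈ (Finset.range (3 ^ (k - 1))).erase j, ∫ x in ivSet L ∩ ivSet (chd k K j'), u x := by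
        rw [← Finset.add_sum_erase _ _ hjr, mul_add]
        apply add_le_add_right
        rw [Finset.mul_sum, Finset.mul_sum]
        apply Finset.sum_le_sum
        intro j' hj'
        obtain ⟨h1, h2⟩ := Finset.mem_erase.1 hj'
        have h3 := Finset.mem_range.1 h2
        exact hone j' h3 (hj0 j' h3 h1)
      have hse := Finset.add_sum_erase _ (fun j' => ∫ x in ivSet L ∩ ivSet (chd k K j'), u x) hjr
      have hSe : 0 ≤ ∑ j' ∈ (Finset.range (3 ^ (k - 1))).erase j, ∫ x in ivSet L ∩ ivSet (chd k K j'), u x :=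
        Finset.sum_nonneg (fun j' _ => hfn j')
      have hchm : ∀ j < 3 ^ (k - 1), ∫ x in ivSet (chd k K j), u x = M * b ^ (i + 1) * (len K / 3 ^ k) := by
        intro j hj; rw [hu.mass (i + 1) _ (chd_mem hK hj), len_chd]
      have hfj : ∫ x in ivSet L ∩ ivSet (chd k K j), u x ≤ M * b ^ (i + 1) * (len K / 3 ^ k) := by
        rw [← hchm j hj]; exact int_mono hu.nonneg hu.int inter_subset_right
      have hYj : 0 ≤ (∫ x in ivSet L ∩ ivSet (chd k K j), u x) ^ q *
          (∫ x in ivSet L ∩ ivSet (chd k K j), v x) / (len K / 3 ^ k) ^ q := by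
        have h1 := hfn j
        have h2 := int_nn hv.nonneg (ivSet L ∩ ivSet (chd k K j))
        positivity
      -- conclusion in the two doubling cases
      have conc : θ * ∑ I ∈ cls k K F L, tau q u v I ≤ 3 * RC q * k * ∫ x in ivSet L, u x →
          2 * (∫ x in ivSet L ∩ ivSet (chd k K j), u x) ≤ ∫ x in ivSet L, u x →
          θ * TT q u v F (ivSet L) +
            2 * YC q * ((∫ x in ivSet L, u x) ^ q * (∫ x in ivSet L, v x) / (len K) ^ q) ≤
            AC q * k * ∫ x in ivSet L, u x := by
        intro h1 h2
        have hSle : ∑ j' ∈ (Finset.range (3 ^ (k - 1))).erase j, ∫ x in ivSet L ∩ ivSet (chd k K j'), u x ≤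
            ∫ x in ivSet L, u x := by
          have := hfn j
          linarith
        have g1 := mul_le_mul_of_nonneg_left hSle (by positivity : 0 ≤ 2 * RC q * k)
        have g2 := mul_le_mul_of_nonneg_left h2 (by have := AC_pos q; positivity : 0 ≤ AC q / 2 * k)
        have g3 := mul_le_mul_of_nonneg_left hY (by positivity : 0 ≤ 2 * YC q)
        have g4 := mul_nonneg (by positivity : 0 ≤ 2 * YC q) hYj
        have g5 : 2 * YC q * ∫ x in ivSet L, u x ≤ 2 * YC q * k * ∫ x in ivSet L, u x := by
          apply mul_le_mul_of_nonneg_right _ hU0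
          nlinarith
        have g6 : AC q * k * ∫ x in ivSet L, u x = AC q / 2 * k * (∫ x in ivSet L, u x) +
            5 * RC q * k * (∫ x in ivSet L, u x) + 2 * YC q * k * ∫ x in ivSet L, u x := by
          unfold AC; ring
        rw [g6]
        have g7 : AC q / 2 * k * (2 * ∫ x in ivSet L ∩ ivSet (chd k K j), u x) =
          AC q * k * ∫ x in ivSet L ∩ ivSet (chd k K j), u x := by ring
        linarith
      by_cases hfull : ∃ j1 < 3 ^ (k - 1), ivSet (chd k K j1) ⊆ ivSet L
      · obtain ⟨j1, hj1, hf1⟩ := hfull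
        apply conc (R_full hk hq hu hv hbc hK hLK hθ hF hj0 hj1 hf1)
        have hne : j1 ≠ j := by rintro rfl; exact hjn hf1
        have h1 := Finset.single_le_sum (fun j' _ => hfn j')
          (Finset.mem_erase.2 ⟨hne, Finset.mem_range.2 hj1⟩)
        rw [inter_eq_right.2 hf1, hchm j1 hj1] at h1
        linarith
      · push Not at hfull
        have hmJ : ivSet (mid K) ∩ ivSet L ⊆ ivSet (chd k K j) := by
          rintro y ⟨hy1, hy2⟩
          obtain ⟨j', hj', hy3⟩ := mid_cover hk hl hy1
          by_cases hne : j' = j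
          · rwa [hne] at hy3
          · rcases hj0 j' hj' hne with h | h
            · exact absurd h (hfull j' hj')
            · exact absurd (show y ∈ (∅ : Set ℝ) from h ▸ ⟨hy2, hy3⟩) (by simp)
        have hmne : (ivSet (mid K) ∩ ivSet L).Nonempty := by
          obtain ⟨y, hy1, hy2⟩ := hje
          exact ⟨y, chd_sub hk hl hj hy2, hy1⟩
        have hempt : ∀ j' ∈ (Finset.range (3 ^ (k - 1))).erase j, ivSet L ∩ ivSet (chd k K j') = ∅ := by
          intro j' hj'
          obtain ⟨h1, h2⟩ := Finset.mem_erase.1 hj'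
          have h3 := Finset.mem_range.1 h2
          rcases hj0 j' h3 h1 with h | h
          · exact absurd h (hfull j' h3)
          · exact h
        by_cases hG : (ivSet (GK k ch K) ∩ ivSet L).Nonempty
        · have hGL := GK_geo hk ch hl hend hfull hmne hG
          have e1 : ivSet L ∩ ivSet (GK k ch K) = ivSet (GK k ch K) := inter_eq_right.2 hGL
          have e3 : volume.real (ivSet (GK k ch K)) = len K / 3 ^ k := by
            have := len_GK k ch K
            rw [vol_ivSet (by simp only [len] at this hD; linarith), this]
          have hUge : b ^ (i + 1) * (len K / 3 ^ k) + ∫ x in ivSet L ∩ ivSet (chd k K j), u x ≤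
              ∫ x in ivSet L, u x := by
            rw [hsu, e1, e3]
            linarith
          have hMb : M * b ^ (i + 1) * (len K / 3 ^ k) ≤ b ^ (i + 1) * (len K / 3 ^ k) := by
            rw [mul_assoc]; exact mul_le_of_le_one_left (by positivity) hu.M1
          apply conc
          · have hR := local_R hk hq hu hv hbc hK hLK hθ (hF.mono (cls_sub k K F L)) cls_L cls_c
            rw [inter_comm (ivSet (GK k ch K)), e1, e3] at hR
            have hmv : volume.real (ivSet (mid K) ∩ ivSet L) ≤ len K / 3 ^ k := by
              have := len_chd k K j
              rw [← this, ← vol_ivSet (by simp only [len] at this hD; linarith)]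
              exact measureReal_mono hmJ (ivSet_fin _)
            have hMq0 : 0 ≤ M ^ q := Real.rpow_nonneg hu.M0 q
            have hMq : M ^ q ≤ 1 := Real.rpow_le_one hu.M0 hu.M1 (by linarith)
            have hMqN : M ^ q * N ≤ 1 := (mul_le_of_le_one_right hMq0 hv.M1).trans hMq
            have hin : M ^ q * N * volume.real (ivSet (mid K) ∩ ivSet L) + len K / 3 ^ k +
                M ^ q * (k * (len K / 3 ^ k)) ≤ 3 * k * (len K / 3 ^ k) := by
              have a1 : M ^ q * N * volume.real (ivSet (mid K) ∩ ivSet L) ≤ len K / 3 ^ k :=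
                (mul_le_of_le_one_left measureReal_nonneg hMqN).trans hmv
              have a2 : M ^ q * (k * (len K / 3 ^ k)) ≤ k * (len K / 3 ^ k) :=
                mul_le_of_le_one_left (by positivity) hMq
              nlinarith
            calc _ ≤ _ := hR
              _ ≤ RC q * b ^ (i + 1) * (3 * k * (len K / 3 ^ k)) :=
                  mul_le_mul_of_nonneg_left hin (by positivity)
              _ = 3 * RC q * k * (b ^ (i + 1) * (len K / 3 ^ k)) := by ring
              _ ≤ _ := by
                  apply mul_le_mul_of_nonneg_left _ (by positivity)
                  linarith [hfn j]
          · linarith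
        · rw [not_nonempty_iff_eq_empty] at hG
          have hR := local_Y hk hq hu hv hK hLK hθ (hF.mono (cls_sub k K F L)) cls_L cls_c hj hmJ hG
          have hsv := split_int hk hv hK (ivSet_meas L) hLK
          have only : ∀ g : ℝ → ℝ, ∑ j' ∈ Finset.range (3 ^ (k - 1)), ∫ x in ivSet L ∩ ivSet (chd k K j'), g x
              = ∫ x in ivSet L ∩ ivSet (chd k K j), g x := by
            intro g
            rw [← Finset.add_sum_erase _ _ hjr, Finset.sum_eq_zero, add_zero]
            intro j' hj'
            rw [hempt j' hj']; simp
          rw [inter_comm] at hG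
          rw [hG, only, measureReal_empty, mul_zero, add_zero] at hsu hsv
          have hz : ∑ j' ∈ (Finset.range (3 ^ (k - 1))).erase j, ∫ x in ivSet L ∩ ivSet (chd k K j'), u x = 0 := by
            apply Finset.sum_eq_zero
            intro j' hj'
            rw [hempt j' hj']; simp
          rw [hz, mul_zero, add_zero] at hsum
          rw [← hsu, ← hsv] at hih hYj
          have h3k := pow3_ge hk
          have hYY : (∫ x in ivSet L, u x) ^ q * (∫ x in ivSet L, v x) / (len K) ^ q ≤
              ((∫ x in ivSet L, u x) ^ q * (∫ x in ivSet L, v x) / (len K / 3 ^ k) ^ q) / 2 := by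
            have hlq : 0 < len K ^ q := Real.rpow_pos_of_pos hl q
            have h3q : (2 : ℝ) ≤ (3 ^ k : ℝ) ^ q := by
              have h1 := Real.rpow_le_rpow_of_exponent_le (by linarith : (1 : ℝ) ≤ 3 ^ k) hq.le
              rw [Real.rpow_one] at h1
              linarith
            rw [Real.div_rpow hl.le (by positivity)]
            have hV0 := int_nn hv.nonneg (ivSet L)
            have hX : 0 ≤ (∫ x in ivSet L, u x) ^ q * (∫ x in ivSet L, v x) / (len K) ^ q := by positivity
            have e : (∫ x in ivSet L, u x) ^ q * (∫ x in ivSet L, v x) / (len K ^ q / (3 ^ k) ^ q) / 2 =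
              ((∫ x in ivSet L, u x) ^ q * (∫ x in ivSet L, v x) / (len K) ^ q) * ((3 ^ k : ℝ) ^ q / 2) := by
              field_simp
            rw [e]
            exact le_mul_of_one_le_right hX (by linarith)
          have g1 := mul_le_mul_of_nonneg_left hYY (by positivity : 0 ≤ 2 * YC q)
          linarith
    · push Not at hpart
      have hall : ∀ j < 3 ^ (k - 1), (ivSet (chd k K j) ⊆ ivSet L ∨ ivSet L ∩ ivSet (chd k K j) = ∅) := by
        intro j hj
        by_contra h
        push Not at h
        exact (hpart j hj).elim (fun h1 => h.1 h1) (fun h1 => h.2.ne_empty h1)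
      have hsum : θ * ∑ j' ∈ Finset.range (3 ^ (k - 1)), TT q u v F (ivSet L ∩ ivSet (chd k K j')) ≤
          2 * RC q * k *
          ∑ j' ∈ Finset.range (3 ^ (k - 1)), ∫ x in ivSet L ∩ ivSet (chd k K j'), u x := by
        rw [Finset.mul_sum, Finset.mul_sum]
        apply Finset.sum_le_sum
        intro j' hj'
        have h3 := Finset.mem_range.1 hj'
        exact hone j' h3 (hall j' h3)
      have hR : θ * ∑ I ∈ cls k K F L, tau q u v I ≤ 3 * RC q * k * ∫ x in ivSet L, u x := by
        by_cases hfull : ∃ j1 < 3 ^ (k - 1), ivSet (chd k K j1) ⊆ ivSet L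
        · obtain ⟨j1, hj1, hf1⟩ := hfull
          exact R_full hk hq hu hv hbc hK hLK hθ hF hj0 hj1 hf1
        · push Not at hfull
          have hE : ivSet (mid K) ∩ ivSet L = ∅ := by
            rw [← subset_empty_iff]
            rintro y ⟨hy1, hy2⟩
            obtain ⟨j', hj', hy3⟩ := mid_cover hk hl hy1
            rcases hall j' hj' with h | h
            · exact absurd h (hfull j' hj')
            · rw [← h]; exact ⟨hy2, hy3⟩
          have hR := local_R2 hk hq hu hv hbc hK hLK hθ (hF.mono (cls_sub k K F L)) cls_L cls_c hE
          rw [inter_comm] at hR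
          have hge : b ^ (i + 1) * volume.real (ivSet L ∩ ivSet (GK k ch K)) ≤ ∫ x in ivSet L, u x := by
            rw [hsu]
            linarith [Finset.sum_nonneg (s := Finset.range (3 ^ (k - 1))) (fun j' _ => hfn j')]
          calc _ ≤ _ := hR
            _ = RC q * (b ^ (i + 1) * volume.real (ivSet L ∩ ivSet (GK k ch K))) := by ring
            _ ≤ RC q * ∫ x in ivSet L, u x := mul_le_mul_of_nonneg_left hge hRC.le
            _ ≤ _ := by
                apply mul_le_mul_of_nonneg_right _ hU0
                nlinarith
      have hSle : ∑ j' ∈ Finset.range (3 ^ (k - 1)), ∫ x in ivSet L ∩ ivSet (chd k K j'), u x ≤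
          ∫ x in ivSet L, u x := by linarith
      have g1 := mul_le_mul_of_nonneg_left hSle (by positivity : 0 ≤ 2 * RC q * k)
      have g3 := mul_le_mul_of_nonneg_left hY (by positivity : 0 ≤ 2 * YC q)
      have g5 : 2 * YC q * ∫ x in ivSet L, u x ≤ 2 * YC q * k * ∫ x in ivSet L, u x := by
        apply mul_le_mul_of_nonneg_right _ hU0
        nlinarith
      have g6 : AC q * k * ∫ x in ivSet L, u x = 10 * RC q * k * (∫ x in ivSet L, u x) +
            4 * YC q * k * ∫ x in ivSet L, u x := by
          unfold AC; ring
      have g7 : 0 ≤ RC q * k * ∫ x in ivSet L, u x := by positivity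
      have g8 : 0 ≤ YC q * k * ∫ x in ivSet L, u x := by positivity
      rw [g6]
      linarith

/-! ### From martingale sparse families to finite Carleson families -/

lemma iv_inj {I J : ℝ × ℝ} (hI : I.1 < I.2) (h : ivSet I = ivSet J) : I = J := by
  have hJ : J.1 < J.2 := by
    by_contra hc
    have : ivSet J = ∅ := Ico_eq_empty hc
    rw [this] at h
    have : I.1 ∈ ivSet I := ⟨le_rfl, hI⟩
    rw [h] at this; exact this
  have h1 := (Ico_subset_Ico_iff hI).1 h.subset
  have h2 := (Ico_subset_Ico_iff hJ).1 h.symm.subset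
  exact Prod.ext (le_antisymm h2.1 h1.1) (le_antisymm h1.2 h2.2)

/-- the exceptional parts -/
def EE (S : Set (ℝ × ℝ)) (I : ℝ × ℝ) : Set ℝ := ivSet I \ ⋃ Q : ↥(maxIn S I), ivSet (Q : ℝ × ℝ)

lemma EE_vol {ε : ℝ} {S : Set (ℝ × ℝ)} (hS : MSparse ε S) {I : ℝ × ℝ} (hI : I ∈ S) :
    MeasurableSet (EE S I) ∧ (1 - ε) * len I ≤ volume.real (EE S I) := by
  obtain ⟨hc, hlt, htri, hsp⟩ := hS
  have hcm : (maxIn S I).Countable := hc.mono (fun Q hQ => hQ.1)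
  have : Countable ↥(maxIn S I) := hcm.to_subtype
  have hmU : MeasurableSet (⋃ Q : ↥(maxIn S I), ivSet (Q : ℝ × ℝ)) :=
    MeasurableSet.iUnion (fun Q => ivSet_meas _)
  have hUI : (⋃ Q : ↥(maxIn S I), ivSet (Q : ℝ × ℝ)) ⊆ ivSet I :=
    iUnion_subset (fun Q => Q.2.2.1.subset)
  refine ⟨(ivSet_meas I).diff hmU, ?_⟩
  have hdisj : Pairwise (Function.onFun Disjoint (fun Q : ↥(maxIn S I) => ivSet (Q : ℝ × ℝ))) := by
    intro Q Q' hne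
    have hne' : (Q : ℝ × ℝ) ≠ Q' := fun h => hne (Subtype.ext h)
    rcases htri Q Q.2.1 Q' Q'.2.1 with h | h | h
    · exact absurd (iv_inj (hlt _ Q'.2.1) (Q.2.2.2 Q' Q'.2.1 h Q'.2.2.1)).symm hne'
    · exact absurd (iv_inj (hlt _ Q.2.1) (Q'.2.2.2 Q Q.2.1 h Q.2.2.1)) hne'
    · exact disjoint_iff_inter_eq_empty.2 h
  have hvol : volume.real (⋃ Q : ↥(maxIn S I), ivSet (Q : ℝ × ℝ)) = ∑' Q : ↥(maxIn S I), len (Q : ℝ × ℝ) := by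
    rw [measureReal_def, measure_iUnion hdisj (fun Q => ivSet_meas _),
      ENNReal.tsum_toReal_eq (fun Q => ivSet_fin _)]
    congr 1
    funext Q
    exact vol_ivSet (hlt _ Q.2.1).le
  have hd : volume.real (EE S I) = volume.real (ivSet I) -
      volume.real (⋃ Q : ↥(maxIn S I), ivSet (Q : ℝ × ℝ)) := by
    unfold EE
    have h1 := measureReal_sdiff_add_inter (μ := volume) (s := ivSet I) hmU (ivSet_fin I)
    rw [inter_eq_right.2 hUI] at h1
    linarith
  rw [hd, hvol, vol_ivSet (hlt I hI).le]
  have := hsp I hI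
  linarith

lemma tau_eq {q : ℝ} {u v : ℝ → ℝ} (hu : ∀ x, 0 ≤ u x) {I : ℝ × ℝ} (hlt : I.1 < I.2) :
    tau q u v I = (∫ x in ivSet I, u x) ^ q * (∫ x in ivSet I, v x) / len I ^ q := by
  have hl : 0 < len I := by simp only [len]; linarith
  unfold tau avg mass
  rw [Real.div_rpow (int_nn hu _) hl.le]
  field_simp

lemma exists_max {q : ℝ} (hq : 1 < q) {u v : ℝ → ℝ} (hu : ∀ x, 0 ≤ u x) (hv : ∀ x, 0 ≤ v x)
    (hui : Integrable u) (hvi : Integrable v)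
    {S : Set (ℝ × ℝ)} (hlt : ∀ I ∈ S, I.1 < I.2) {L : ℝ × ℝ}
    (hsum : Summable (fun I : ↥{I | I ∈ S ∧ ivSet I ⊆ ivSet L} => tau q u v (I : ℝ × ℝ)))
    {A B : ℝ × ℝ} (hA : A ∈ S) (hB : B ∈ S) (hBL : ivSet B ⊆ ivSet L) (hAB : ivSet A ⊂ ivSet B)
    (ht : tau q u v A ≠ 0) : ∃ Q ∈ maxIn S B, ivSet A ⊆ ivSet Q := by
  have hlA : 0 < len A := by have := hlt A hA; simp only [len]; linarith
  have hlB : 0 < len B := by have := hlt B hB; simp only [len]; linarith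
  have hA0 := int_nn hu (ivSet A)
  have hA0' := int_nn hv (ivSet A)
  have hApos : 0 < (∫ x in ivSet A, u x) ^ q * (∫ x in ivSet A, v x) := by
    rw [tau_eq hu (hlt A hA)] at ht
    have h1 : 0 ≤ (∫ x in ivSet A, u x) ^ q * (∫ x in ivSet A, v x) := by positivity
    rcases h1.eq_or_lt with h | h
    · rw [← h] at ht; simp at ht
    · exact h
  have hBq : 0 < len B ^ q := Real.rpow_pos_of_pos hlB q
  have hδ := div_pos hApos hBq
  set δ := (∫ x in ivSet A, u x) ^ q * (∫ x in ivSet A, v x) / len B ^ q with hδd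
  set Z : Set (ℝ × ℝ) := {Q | Q ∈ S ∧ ivSet A ⊆ ivSet Q ∧ ivSet Q ⊂ ivSet B} with hZ
  have hfin0 : {x : ↥{I | I ∈ S ∧ ivSet I ⊆ ivSet L} | ¬ tau q u v (x : ℝ × ℝ) < δ}.Finite := by
    have := hsum.tendsto_cofinite_zero.eventually (eventually_lt_nhds hδ)
    exact Filter.eventually_cofinite.1 this
  have hZfin : Z.Finite := by
    apply (hfin0.image Subtype.val).subset
    rintro Q ⟨hQS, hAQ, hQB⟩
    refine ⟨⟨Q, hQS, hQB.subset.trans hBL⟩, ?_, rfl⟩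
    show ¬ tau q u v Q < δ
    rw [not_lt, tau_eq hu (hlt Q hQS), hδd]
    have hlQ : 0 < len Q := by have := hlt Q hQS; simp only [len]; linarith
    have h1 := (Ico_subset_Ico_iff (hlt Q hQS)).1 hQB.subset
    have hle : len Q ≤ len B := by simp only [len]; linarith [h1.1, h1.2]
    have m1 := int_mono hu hui hAQ
    have m2 := int_mono hv hvi hAQ
    have hQq : 0 < len Q ^ q := Real.rpow_pos_of_pos hlQ q
    have n1 := int_nn hu (ivSet Q)
    have n2 := int_nn hv (ivSet Q)
    gcongr
  obtain ⟨Q, hQZ, hQmax⟩ := Set.exists_max_image Z len hZfin ⟨A, hA, subset_rfl, hAB⟩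
  refine ⟨Q, ⟨hQZ.1, hQZ.2.2, ?_⟩, hQZ.2.1⟩
  intro Q' hQ' hQQ' hQ'B
  have h1 := hQmax Q' ⟨hQ', hQZ.2.1.trans hQQ', hQ'B⟩
  have h2 := (Ico_subset_Ico_iff (hlt Q hQZ.1)).1 hQQ'
  apply subset_antisymm _ hQQ'
  simp only [len] at h1
  exact Ico_subset_Ico (by linarith [h2.1, h2.2]) (by linarith [h2.1, h2.2])

lemma test_bound {k : ℕ} (hk : 3000 < k) {ch : ℝ × ℝ → Bool} {u v : ℝ → ℝ} {b M c N q : ℝ} (hq : 1 < q)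
    (hu : Good k ch u b M) (hv : Good k ch v c N) (hbc : b ^ q * c = b) (hMN : M ^ q * N ≤ 2 / 3 ^ k)
    {ε : ℝ} (hε : ε < 1) {S : Set (ℝ × ℝ)} (hS : MSparse ε S)
    {K : ℝ × ℝ} (hK : K ∈ KK k) {L : ℝ × ℝ} (hLK : ivSet L ⊆ ivSet K) (hend : L.1 = K.1 ∨ L.2 = K.2) :
    sumTest q u v {I | I ∈ S ∧ ivSet I ⊆ ivSet L} ≤ AC q * k * mass u L / (1 - ε) := by
  classical
  have hθ : 0 < 1 - ε := by linarith
  have hAC := AC_pos q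
  have hU0 := int_nn hu.nonneg (ivSet L)
  have hlt := hS.2.1
  obtain ⟨i, hK⟩ := mem_iUnion.1 hK
  show ∑' I : ↥{I | I ∈ S ∧ ivSet I ⊆ ivSet L}, tau q u v (I : ℝ × ℝ) ≤
    AC q * k * (∫ x in ivSet L, u x) / (1 - ε)
  by_cases hsum : Summable (fun I : ↥{I | I ∈ S ∧ ivSet I ⊆ ivSet L} => tau q u v (I : ℝ × ℝ))
  swap
  · rw [tsum_eq_zero_of_not_summable hsum]; positivity
  apply hsum.tsum_le_of_sum_le
  intro s
  set F0 : Finset (ℝ × ℝ) := s.map (Function.Embedding.subtype _) with hF0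
  have hF0m : ∀ I ∈ F0, I ∈ S ∧ ivSet I ⊆ ivSet L := by
    intro I hI
    obtain ⟨J, _, rfl⟩ := Finset.mem_map.1 hI
    exact J.2
  set F := F0.filter (fun I => tau q u v I ≠ 0) with hFd
  have hFm : ∀ I ∈ F, (I ∈ S ∧ ivSet I ⊆ ivSet L) ∧ tau q u v I ≠ 0 := by
    intro I hI
    obtain ⟨h1, h2⟩ := Finset.mem_filter.1 hI
    exact ⟨hF0m I h1, h2⟩
  have hsF : ∑ I ∈ s, tau q u v (I : ℝ × ℝ) = ∑ I ∈ F, tau q u v I := by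
    rw [hFd, Finset.sum_filter_ne_zero, hF0, Finset.sum_map]; rfl
  have hnest : ∀ A ∈ F, ∀ B ∈ F, A ≠ B → ivSet A ⊆ ivSet B → Disjoint (EE S A) (EE S B) := by
    intro A hA B hB hne hAB
    obtain ⟨⟨hAS, hAL⟩, hAt⟩ := hFm A hA
    obtain ⟨⟨hBS, hBL⟩, hBt⟩ := hFm B hB
    have hss : ivSet A ⊂ ivSet B :=
      HasSubset.Subset.ssubset_of_ne hAB (fun h => hne (iv_inj (hlt A hAS) h))
    obtain ⟨Q, hQ, hAQ⟩ := exists_max hq hu.nonneg hv.nonneg hu.int hv.int hlt hsum hAS hBS hBL hss hAt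
    rw [Set.disjoint_left]
    intro x hxA hxB
    exact hxB.2 (mem_iUnion.2 ⟨⟨Q, hQ⟩, hAQ hxA.1⟩)
  have hCF : CF (1 - ε) F (EE S) := by
    refine ⟨?_, ?_⟩
    · intro I hI
      have hIS := (hFm I hI).1.1
      have h := EE_vol hS hIS
      exact ⟨hlt I hIS, h.1, diff_subset, h.2⟩
    · intro A hA B hB hne
      rcases hS.2.2.1 A (hFm A hA).1.1 B (hFm B hB).1.1 with h | h | h
      · exact hnest A hA B hB hne h
      · exact (hnest B hB A hA hne.symm h).symm
      · exact (disjoint_iff_inter_eq_empty.2 h).mono diff_subset diff_subset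
  have hn : ∃ n : ℕ, ∀ I ∈ F, 1 / ((3 : ℝ) ^ k) ^ (i + n) < len I := by
    have h3 := pow3_ge hk
    have hinv : 1 / (3 : ℝ) ^ k < 1 := by
      rw [div_lt_one (by positivity)]; linarith
    have hpos : 0 ≤ 1 / (3 : ℝ) ^ k := by positivity
    have ht : Tendsto (fun n : ℕ => (1 / (3 : ℝ) ^ k) ^ (i + n)) atTop (nhds 0) := by
      have := (tendsto_pow_atTop_nhds_zero_of_lt_one hpos hinv).comp (tendsto_add_atTop_nat i)
      refine this.congr (fun n => ?_)
      simp only [Function.comp]; rw [add_comm]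
    have hev : ∀ᶠ n : ℕ in atTop, ∀ I ∈ F, (1 / (3 : ℝ) ^ k) ^ (i + n) < len I := by
      rw [Filter.eventually_all_finset]
      intro I hI
      apply ht.eventually (eventually_lt_nhds _)
      have := hlt I (hFm I hI).1.1
      simp only [len]; linarith
    obtain ⟨n, hn⟩ := hev.exists
    refine ⟨n, fun I hI => ?_⟩
    have := hn I hI
    rwa [one_div_pow] at this
  obtain ⟨n, hn⟩ := hn
  have hmain := part_bound hk hq hu hv hbc hMN hθ hCF n i K hK hn L hLK hend
  have hTT : TT q u v F (ivSet L) = ∑ I ∈ F, tau q u v I := by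
    unfold TT
    congr 1
    apply Finset.filter_true_of_mem
    intro I hI
    exact (hFm I hI).1.2
  have hYpos : 0 ≤ 2 * YC q * ((∫ x in ivSet L, u x) ^ q * (∫ x in ivSet L, v x) / (len K) ^ q) := by
    have h1 := YC_nonneg q
    have h2 := int_nn hv.nonneg (ivSet L)
    have h3 := (len_Kfam_pos hK).le
    positivity
  rw [hsF, le_div_iff₀ hθ]
  rw [hTT] at hmain
  linarith
/-- Lemma 4.10 of the paper: local testing conditions for subintervals `L` of `K ∈ 𝐊`
sharing an endpoint with `K`, with bounds `C(p)·k·w_k(L)/(1-ε)` and `C(p)·k·σ_k(L)/(1-ε)`. -/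
theorem statement11 (p : ℝ) (hp : 1 < p) :
    ∃ C : ℝ, 0 < C ∧ ∀ k : ℕ, 3000 < k → ∀ ch : ℝ × ℝ → Bool,
      ∀ ε : ℝ, 0 < ε → ε < 1 → ∀ S : Set (ℝ × ℝ), MSparse ε S →
      (∀ I ∈ S, ivSet I ⊆ Set.Ico (0 : ℝ) 1) →
      ∀ K ∈ KK k, ∀ L : ℝ × ℝ, L.1 < L.2 → ivSet L ⊆ ivSet K →
        (L.1 = K.1 ∨ L.2 = K.2) →
        sumTest p (wgt k ch) (sgm p k ch) {I | I ∈ S ∧ ivSet I ⊆ ivSet L} ≤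
          C * (k : ℝ) * mass (wgt k ch) L / (1 - ε) ∧
        sumTest (p / (p - 1)) (sgm p k ch) (wgt k ch) {I | I ∈ S ∧ ivSet I ⊆ ivSet L} ≤
          C * (k : ℝ) * mass (sgm p k ch) L / (1 - ε) := by
  have hp1 : 0 < p - 1 := by linarith
  have hq' : 1 < p / (p - 1) := by rw [lt_div_iff₀ hp1]; linarith
  have hA1 := AC_pos p
  have hA2 := AC_pos (p / (p - 1))
  refine ⟨AC p + AC (p / (p - 1)), by positivity, ?_⟩
  intro k hk ch ε hε0 hε1 S hS _ K hK L _ hLK hend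
  have ha : 0 < aa k := lt_of_lt_of_le one_pos (aa_ge hk)
  have hw := w_good hk ch
  obtain ⟨M, hM, hs⟩ := s_good hp hk ch
  have hθ : 0 < 1 - ε := by linarith
  constructor
  · refine (test_bound hk hp hw hs ?_ ?_ hε1 hS hK hLK hend).trans ?_
    · rw [← Real.rpow_add ha]; simp
    · simpa using hM
    · have h0 : 0 ≤ mass (wgt k ch) L := int_nn hw.nonneg _
      gcongr
      linarith
  · refine (test_bound hk hq' hs hw ?_ ?_ hε1 hS hK hLK hend).trans ?_
    · have e : (1 - p) * (p / (p - 1)) + 1 = 1 - p := by field_simp; ring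
      rw [← Real.rpow_mul ha.le]
      nth_rewrite 2 [← Real.rpow_one (aa k)]
      rw [← Real.rpow_add ha, e]
    · have h1 := Real.rpow_le_rpow_of_exponent_ge' hs.M0 hs.M1 zero_le_one hq'.le
      rw [Real.rpow_one] at h1
      linarith
    · have h0 : 0 ≤ mass (sgm p k ch) L := int_nn hs.nonneg _
      gcongr
      linarith

end RTpaper
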